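/- arXiv:1207.5440 — 3 statements merged into one kernel-verified Lean document; each statement's English description precedes it below -/
import Mathlib

section
/- Let U ⊆ ℝ² be a contractible open set and let a, b : U → ℝ be smooth functions. Then the pair of equations X³b = (X²Y + XZ + W)a and Y²a = (YX − Z)b holds on U if and only if there exist a smooth function f : U → ℝ and constants C, D ∈ ℝ such that Xf = a and (Yf)(x,y) = C·x + D + b(x,y) on U. -/
/-- Second Grushin operator `X = ∂/∂x` on `ℝ²` with coordinates `(x, y)`. -/
noncomputable def opX (f : (Fin 2 → ℝ) → ℝ) : (Fin 2 → ℝ) → ℝ :=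
  fun p => fderiv ℝ f p ![1, 0]

/-- Second Grushin operator `Y = x² ∂/∂y` on `ℝ²`. -/
noncomputable def opY (f : (Fin 2 → ℝ) → ℝ) : (Fin 2 → ℝ) → ℝ :=
  fun p => fderiv ℝ f p ![0, (p 0) ^ 2]

/-- Second Grushin operator `Z = [X, Y] = 2x ∂/∂y` on `ℝ²`. -/
noncomputable def opZ (f : (Fin 2 → ℝ) → ℝ) : (Fin 2 → ℝ) → ℝ :=
  fun p => fderiv ℝ f p ![0, 2 * p 0]

/-- Second Grushin operator `W = [X, Z] = 2 ∂/∂y` on `ℝ²`. -/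
noncomputable def opW (f : (Fin 2 → ℝ) → ℝ) : (Fin 2 → ℝ) → ℝ :=
  fun p => fderiv ℝ f p ![0, 2]

open Set Filter Topology

open scoped unitInterval ContDiff

/-! ### Closed one-forms on contractible open sets -/

section Primitive

variable {E T : Type*} [NormedAddCommGroup E] [NormedSpace ℝ E] [TopologicalSpace T]

/-- `φ` is a primitive of the one-form `η` in a neighbourhood of `p`. -/
def IsPrimitiveNear (η : E → E →L[ℝ] ℝ) (φ : E → ℝ) (p : E) : Prop :=
  ∀ᶠ q in 𝓝 p, HasFDerivAt φ (η q) q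

/-- `G` is a primitive of `η` along the map `γ` on the set `S`: locally on `S`, it is the pullback
under `γ` of a local primitive of `η`. -/
def IsPrimitiveAlong (η : E → E →L[ℝ] ℝ) (γ : T → E) (G : T → ℝ) (S : Set T) : Prop :=
  ∀ t ∈ S, ∃ φ, IsPrimitiveNear η φ (γ t) ∧ ∀ᶠ s in 𝓝[S] t, G s = φ (γ s)

variable {η : E → E →L[ℝ] ℝ} {γ : T → E} {S : Set T}

lemma IsPrimitiveNear.add_const {φ : E → ℝ} {p : E} (h : IsPrimitiveNear η φ p) (c : ℝ) :
    IsPrimitiveNear η (fun q => φ q + c) p :=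
  Eventually.mono h fun _ hq => hq.add_const c

lemma IsPrimitiveNear.eventually_sub_eq {φ ψ : E → ℝ} {p : E} (hφ : IsPrimitiveNear η φ p)
    (hψ : IsPrimitiveNear η ψ p) : ∀ᶠ q in 𝓝 p, φ q - ψ q = φ p - ψ p := by
  obtain ⟨r, hr, hball⟩ := Metric.eventually_nhds_iff_ball.1 (hφ.and hψ)
  filter_upwards [Metric.ball_mem_nhds p hr] with q hq
  have hd : ∀ z ∈ Metric.ball p r, HasFDerivAt (fun z => φ z - ψ z) (0 : E →L[ℝ] ℝ) z := fun z hz =>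
    by simpa using (hball z hz).1.fun_sub (hball z hz).2
  exact Metric.isOpen_ball.is_const_of_fderiv_eq_zero (convex_ball p r).isPreconnected
    (fun z hz => (hd z hz).differentiableAt.differentiableWithinAt) (fun z hz => (hd z hz).fderiv)
    hq (Metric.mem_ball_self hr)

lemma IsPrimitiveAlong.mono {G : T → ℝ} {S' : Set T} (h : IsPrimitiveAlong η γ G S)
    (hS : S' ⊆ S) : IsPrimitiveAlong η γ G S' := fun t ht =>
  (h t (hS ht)).imp fun _ hφ => ⟨hφ.1, hφ.2.filter_mono (nhdsWithin_mono t hS)⟩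

lemma IsPrimitiveAlong.comp {T' : Type*} [TopologicalSpace T'] {G : T → ℝ}
    (h : IsPrimitiveAlong η γ G S) {ι : T' → T} (hι : Continuous ι) {S' : Set T'}
    (hS : MapsTo ι S' S) : IsPrimitiveAlong η (γ ∘ ι) (G ∘ ι) S' := fun t ht =>
  (h (ι t) (hS ht)).imp fun _ hφ =>
    ⟨hφ.1, (hι.continuousWithinAt.tendsto_nhdsWithin hS).eventually hφ.2⟩

/-- Two primitives along the same map differ by a constant on preconnected sets. -/
lemma IsPrimitiveAlong.sub_eq {G₁ G₂ : T → ℝ} (hγ : Continuous γ) (hS : IsPreconnected S)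
    (h₁ : IsPrimitiveAlong η γ G₁ S) (h₂ : IsPrimitiveAlong η γ G₂ S) {s t : T} (hs : s ∈ S)
    (ht : t ∈ S) : G₁ s - G₂ s = G₁ t - G₂ t := by
  have hloc : IsLocallyConstant (fun t : S => G₁ t - G₂ t) := by
    rw [IsLocallyConstant.iff_eventually_eq]
    rintro ⟨t, ht⟩
    obtain ⟨φ, hφ, hφG⟩ := h₁ t ht
    obtain ⟨ψ, hψ, hψG⟩ := h₂ t ht
    have hsub := hγ.continuousAt.eventually (hφ.eventually_sub_eq hψ)
    have key : ∀ᶠ s in 𝓝[S] t, G₁ s - G₂ s = G₁ t - G₂ t := by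
      filter_upwards [hφG, hψG, hsub.filter_mono nhdsWithin_le_nhds] with s h1 h2 h3
      rw [h1, h2, h3, hφG.self_of_nhdsWithin ht, hψG.self_of_nhdsWithin ht]
    rw [nhdsWithin_eq_map_subtype_coe ht, eventually_map] at key
    exact key
  have := isPreconnected_iff_preconnectedSpace.1 hS
  exact hloc.apply_eq_of_preconnectedSpace ⟨s, hs⟩ ⟨t, ht⟩

/-- Along a homotopy `H`, a locally exact one-form has a primitive on a tube around each path. -/
lemma exists_isPrimitiveAlong_tube {A : Type*} [TopologicalSpace A] {H : A × I → E}
    (hH : Continuous H) (hη : ∀ z, ∃ φ, IsPrimitiveNear η φ (H z)) (a₀ : A) :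
    ∃ V ∈ 𝓝 a₀, ∃ G : A × I → ℝ, IsPrimitiveAlong η H G (V ×ˢ univ) := by
  choose φ hφ using fun s => hη (a₀, s)
  have hnhds : ∀ s, ∃ V J, IsOpen V ∧ a₀ ∈ V ∧ IsOpen J ∧ s ∈ J ∧
      ∀ a ∈ V, ∀ t ∈ J, IsPrimitiveNear η (φ s) (H (a, t)) := by
    intro s
    have h : ∀ᶠ z in 𝓝 (a₀, s), IsPrimitiveNear η (φ s) (H z) :=
      hH.continuousAt.eventually (eventually_eventually_nhds.2 (hφ s))
    obtain ⟨V, J, hV, haV, hJ, hsJ, hVJ⟩ := mem_nhds_prod_iff'.1 h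
    exact ⟨V, J, hV, haV, hJ, hsJ, fun a ha t ht => hVJ (mk_mem_prod ha ht)⟩
  choose V J hV haV hJ hsJ hVJ using hnhds
  obtain ⟨t, ht0, htmono, ⟨N, hN⟩, htJ⟩ := exists_monotone_Icc_subset_open_cover_unitInterval
    hJ (fun s _ => mem_iUnion.2 ⟨s, hsJ s⟩)
  suffices h : ∀ n, ∃ W ∈ 𝓝 a₀, ∃ G : A × I → ℝ, IsPrimitiveAlong η H G (W ×ˢ Icc 0 (t n)) by
    obtain ⟨W, hW, G, hG⟩ := h N
    refine ⟨W, hW, G, hG.mono (prod_mono_right fun s _ => ?_)⟩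
    rw [hN N le_rfl]
    exact ⟨s.2.1, s.2.2⟩
  intro n
  induction n with
  | zero =>
    refine ⟨V 0, (hV 0).mem_nhds (haV 0), fun z => φ 0 (H z), ?_⟩
    rintro ⟨a, s⟩ ⟨ha, hs⟩
    obtain rfl : s = 0 := by simpa [ht0] using hs
    exact ⟨φ 0, hVJ 0 a ha 0 (hsJ 0), Eventually.of_forall fun _ => rfl⟩
  | succ n ih =>
    obtain ⟨W, hW, G, hG⟩ := ih
    obtain ⟨s, hs⟩ := htJ n
    have htn : t n ∈ J s := hs (left_mem_Icc.2 (htmono n.le_succ))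
    set c := G (a₀, t n) - φ s (H (a₀, t n)) with hc
    have hmemW : ∀ a ∈ W, (a, t n) ∈ W ×ˢ Icc 0 (t n) := fun a ha => ⟨ha, (t n).2.1, le_rfl⟩
    have hglue : ∀ᶠ a in 𝓝 a₀, G (a, t n) - φ s (H (a, t n)) = c := by
      obtain ⟨ψ, hψ, hψG⟩ := hG (a₀, t n) (hmemW a₀ (mem_of_mem_nhds hW))
      have h1 := hψ.eventually_sub_eq (hVJ s a₀ (haV s) (t n) htn)
      have hcont : Continuous fun a : A => (a, t n) := by fun_prop
      have h2 : Tendsto (fun a : A => (a, t n)) (𝓝 a₀) (𝓝[W ×ˢ Icc 0 (t n)] (a₀, t n)) :=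
        tendsto_nhdsWithin_iff.2 ⟨hcont.tendsto a₀, Eventually.mono hW hmemW⟩
      filter_upwards [(hH.comp hcont).continuousAt.eventually h1, h2.eventually hψG] with a h3 h4
      simp only [Function.comp_apply] at h3
      rw [h4, h3, hc, hψG.self_of_nhdsWithin (hmemW a₀ (mem_of_mem_nhds hW))]
    refine ⟨W ∩ V s ∩ {a | G (a, t n) - φ s (H (a, t n)) = c},
      inter_mem (inter_mem hW ((hV s).mem_nhds (haV s))) hglue,
      fun z => if z.2 ≤ t n then G z else φ s (H z) + c, ?_⟩
    rintro ⟨a, r⟩ ⟨⟨⟨haW, haV⟩, hac⟩, hr0, hr1⟩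
    have hac : G (a, t n) - φ s (H (a, t n)) = c := hac
    rcases lt_trichotomy r (t n) with hlt | rfl | hgt
    · obtain ⟨ψ, hψ, hψG⟩ := hG (a, r) ⟨haW, hr0, hlt.le⟩
      refine ⟨ψ, hψ, ?_⟩
      have hnear : ∀ᶠ z : A × I in 𝓝 (a, r), z.2 < t n :=
        continuous_snd.continuousAt.eventually (eventually_lt_nhds hlt)
      rw [eventually_nhdsWithin_iff] at hψG ⊢
      filter_upwards [hψG, hnear] with z hz hzt hzS
      rw [if_pos hzt.le]
      exact hz ⟨hzS.1.1.1, hzS.2.1, hzt.le⟩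
    · obtain ⟨ψ, hψ, hψG⟩ := hG (a, t n) (hmemW a haW)
      have hφa := hVJ s a haV (t n) htn
      refine ⟨fun q => φ s q + c, hφa.add_const c, ?_⟩
      have hsub := hH.continuousAt.eventually (hψ.eventually_sub_eq hφa)
      rw [← hψG.self_of_nhdsWithin (hmemW a haW), hac] at hsub
      rw [eventually_nhdsWithin_iff] at hψG ⊢
      filter_upwards [hψG, hsub] with z hz hzc hzS
      split_ifs with hzt
      · rw [hz ⟨hzS.1.1.1, hzS.2.1, hzt⟩]
        linarith
      · rfl
    · refine ⟨fun q => φ s q + c, (hVJ s a haV r (hs ⟨hgt.le, hr1⟩)).add_const c, ?_⟩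
      have hnear : ∀ᶠ z : A × I in 𝓝 (a, r), t n < z.2 :=
        continuous_snd.continuousAt.eventually (eventually_gt_nhds hgt)
      filter_upwards [hnear.filter_mono nhdsWithin_le_nhds] with z hz
      rw [if_neg hz.not_ge]

/-- A locally exact one-form on a contractible open set is exact. -/
theorem exists_primitive_of_contractibleSpace {U : Set E} (hU : IsOpen U) [ContractibleSpace U]
    (hη : ∀ p ∈ U, ∃ φ, IsPrimitiveNear η φ p) : ∃ f : E → ℝ, ∀ p ∈ U, HasFDerivAt f (η p) p := by
  obtain ⟨c, ⟨K⟩⟩ := id_nullhomotopic U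
  set H : U × I → E := fun z => K (z.2, z.1) with hHdef
  have hH : Continuous H := by fun_prop
  choose V hV G hG using exists_isPrimitiveAlong_tube (η := η) hH
    (fun z => hη (H z) (K (z.2, z.1)).2)
  have hpath : ∀ a b, b ∈ V a → G a (b, 0) - G b (b, 0) = G a (b, 1) - G b (b, 1) := by
    intro a b hb
    have hcont : Continuous fun s : I => (b, s) := by fun_prop
    exact IsPrimitiveAlong.sub_eq (hH.comp hcont) isPreconnected_univ
      ((hG a).comp hcont fun s _ => ⟨hb, trivial⟩)
      ((hG b).comp hcont fun s _ => ⟨mem_of_mem_nhds (hV b), trivial⟩) (mem_univ 0) (mem_univ 1)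
  classical
  refine ⟨fun p => if h : p ∈ U then G ⟨p, h⟩ (⟨p, h⟩, 0) - G ⟨p, h⟩ (⟨p, h⟩, 1) else 0,
    fun p hp => ?_⟩
  set a : U := ⟨p, hp⟩
  have hend : ∀ r, ∃ φ, IsPrimitiveNear η φ (H (a, r)) ∧
      ∀ᶠ b in 𝓝 a, G a (b, r) = φ (H (b, r)) := by
    intro r
    obtain ⟨φ, hφ, hφG⟩ := hG a (a, r) ⟨mem_of_mem_nhds (hV a), trivial⟩
    refine ⟨φ, hφ, ?_⟩
    have hcont : Continuous fun b : U => (b, r) := by fun_prop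
    have h : Tendsto (fun b : U => (b, r)) (𝓝 a) (𝓝[V a ×ˢ univ] (a, r)) :=
      tendsto_nhdsWithin_iff.2
        ⟨hcont.tendsto a, Eventually.mono (hV a) fun b hb => ⟨hb, trivial⟩⟩
    exact h.eventually hφG
  obtain ⟨φ, hφ, hφG⟩ := hend 0
  obtain ⟨ψ, -, hψG⟩ := hend 1
  have hH0 : ∀ b : U, H (b, 0) = b := fun b => by simp [hHdef]
  have hH1 : ∀ b : U, H (b, 1) = c := fun b => by simp [hHdef]
  rw [hH0] at hφ
  refine (hφ.self_of_nhds.sub_const (ψ c)).congr_of_eventuallyEq ?_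
  have key : ∀ᶠ b : U in 𝓝 a, G b (b, 0) - G b (b, 1) = φ b - ψ c := by
    filter_upwards [hφG, hψG, hV a] with b h1 h2 h3
    have h4 := hpath a b h3
    rw [hH0] at h1
    rw [hH1] at h2
    linarith
  have key' : ∀ᶠ q in 𝓝 p, ∀ h : q ∈ U, G ⟨q, h⟩ (⟨q, h⟩, 0) - G ⟨q, h⟩ (⟨q, h⟩, 1)
      = φ q - ψ c := by
    rw [nhds_subtype_eq_comap] at key
    obtain ⟨s, hs, hsub⟩ := key
    filter_upwards [hs] with q hq hqU
    exact hsub (a := ⟨q, hqU⟩) hq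
  filter_upwards [key', hU.mem_nhds hp] with q hq hqU
  rw [dif_pos hqU]
  exact hq hqU

end Primitive

/-! ### Partial derivatives on the plane -/

/-- The covector `u dx + v dy` on `ℝ²`. -/
noncomputable def covector (u v : ℝ) : (Fin 2 → ℝ) →L[ℝ] ℝ :=
  u • ContinuousLinearMap.proj 0 + v • ContinuousLinearMap.proj 1

@[simp]
lemma covector_apply (u v : ℝ) (w : Fin 2 → ℝ) : covector u v w = u * w 0 + v * w 1 := by
  simp [covector]

/-- `f` is differentiable on `U` with partial derivatives `fx` and `fy`. -/
def HasPartialsOn (U : Set (Fin 2 → ℝ)) (f fx fy : (Fin 2 → ℝ) → ℝ) : Prop :=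
  ∀ p ∈ U, HasFDerivAt f (covector (fx p) (fy p)) p

/-- The partial derivative `∂/∂y` on `ℝ²`. -/
noncomputable def partialY (f : (Fin 2 → ℝ) → ℝ) : (Fin 2 → ℝ) → ℝ :=
  fun p => fderiv ℝ f p ![0, 1]

lemma fderiv_vec_zero_left (f : (Fin 2 → ℝ) → ℝ) (p : Fin 2 → ℝ) (c : ℝ) :
    fderiv ℝ f p ![0, c] = c * partialY f p := by
  rw [partialY, ← smul_eq_mul, ← map_smul]
  simp

lemma opY_eq (f : (Fin 2 → ℝ) → ℝ) : opY f = fun p => p 0 ^ 2 * partialY f p :=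
  funext fun _ => fderiv_vec_zero_left f _ _

lemma opZ_eq (f : (Fin 2 → ℝ) → ℝ) : opZ f = fun p => 2 * p 0 * partialY f p :=
  funext fun _ => fderiv_vec_zero_left f _ _

lemma opW_eq (f : (Fin 2 → ℝ) → ℝ) : opW f = fun p => 2 * partialY f p :=
  funext fun _ => fderiv_vec_zero_left f _ _

section Partials

variable {U : Set (Fin 2 → ℝ)} {f fx fy g gx gy : (Fin 2 → ℝ) → ℝ}

lemma HasPartialsOn.opX_eqOn (h : HasPartialsOn U f fx fy) : EqOn (opX f) fx U := fun p hp => by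
  simp [opX, (h p hp).fderiv]

lemma HasPartialsOn.partialY_eqOn (h : HasPartialsOn U f fx fy) : EqOn (partialY f) fy U :=
  fun p hp => by simp [partialY, (h p hp).fderiv]

lemma HasPartialsOn.congr (h : HasPartialsOn U f fx fy) (hU : IsOpen U) (hg : EqOn g f U) :
    HasPartialsOn U g fx fy := fun p hp =>
  (h p hp).congr_of_eventuallyEq (hg.eventuallyEq_of_mem (hU.mem_nhds hp))

lemma HasPartialsOn.sub (hf : HasPartialsOn U f fx fy) (hg : HasPartialsOn U g gx gy) :
    HasPartialsOn U (fun p => f p - g p) (fun p => fx p - gx p) (fun p => fy p - gy p) :=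
  fun p hp => ((hf p hp).fun_sub (hg p hp)).congr_fderiv <| by
    ext w
    simp
    ring

lemma HasPartialsOn.add (hf : HasPartialsOn U f fx fy) (hg : HasPartialsOn U g gx gy) :
    HasPartialsOn U (fun p => f p + g p) (fun p => fx p + gx p) (fun p => fy p + gy p) :=
  fun p hp => ((hf p hp).fun_add (hg p hp)).congr_fderiv <| by
    ext w
    simp
    ring

lemma HasPartialsOn.mul (hf : HasPartialsOn U f fx fy) (hg : HasPartialsOn U g gx gy) :
    HasPartialsOn U (fun p => f p * g p) (fun p => fx p * g p + f p * gx p)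
      (fun p => fy p * g p + f p * gy p) := fun p hp =>
    ((hf p hp).fun_mul (hg p hp)).congr_fderiv <| by
  ext w
  simp
  ring

lemma hasPartialsOn_const (c : ℝ) : HasPartialsOn U (fun _ => c) (fun _ => 0) (fun _ => 0) :=
  fun p _ => (hasFDerivAt_const c p).congr_fderiv <| by
    ext w
    simp

lemma hasPartialsOn_fst : HasPartialsOn U (fun p => p 0) (fun _ => 1) (fun _ => 0) :=
  fun p _ => (hasFDerivAt_apply 0 p).congr_fderiv <| by
    ext w
    simp

lemma hasPartialsOn_fst_pow (n : ℕ) :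
    HasPartialsOn U (fun p => p 0 ^ n) (fun p => n * p 0 ^ (n - 1)) (fun _ => 0) := fun p hp =>
    ((hasPartialsOn_fst p hp).pow n).congr_fderiv <| by
  ext w
  simp

lemma HasPartialsOn.exists_eq_const (hU : IsOpen U) (hUc : IsPreconnected U)
    (h : HasPartialsOn U f fx fy) (hx : ∀ p ∈ U, fx p = 0) (hy : ∀ p ∈ U, fy p = 0) :
    ∃ c, ∀ p ∈ U, f p = c := by
  refine hU.exists_is_const_of_fderiv_eq_zero (𝕜 := ℝ) hUc
    (fun p hp => (h p hp).differentiableAt.differentiableWithinAt) fun p hp => ?_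
  rw [(h p hp).fderiv, hx p hp, hy p hp]
  ext w
  simp

lemma contDiffOn_covector {n : WithTop ℕ∞} (hf : ContDiffOn ℝ n f U) (hg : ContDiffOn ℝ n g U) :
    ContDiffOn ℝ n (fun p => covector (f p) (g p)) U :=
  (hf.smul contDiffOn_const).add (hg.smul contDiffOn_const)

lemma ContDiffOn.fderiv_apply_const (hU : IsOpen U) (hf : ContDiffOn ℝ ∞ f U) (v : Fin 2 → ℝ) :
    ContDiffOn ℝ ∞ (fun p => fderiv ℝ f p v) U :=
  (hf.fderiv_of_isOpen hU (by simp)).clm_apply contDiffOn_const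

lemma ContDiffOn.opX (hU : IsOpen U) (hf : ContDiffOn ℝ ∞ f U) : ContDiffOn ℝ ∞ (opX f) U :=
  hf.fderiv_apply_const hU _

lemma ContDiffOn.partialY (hU : IsOpen U) (hf : ContDiffOn ℝ ∞ f U) :
    ContDiffOn ℝ ∞ (partialY f) U :=
  hf.fderiv_apply_const hU _

lemma hasPartialsOn_of_contDiffOn (hU : IsOpen U) (hf : ContDiffOn ℝ ∞ f U) :
    HasPartialsOn U f (opX f) (partialY f) := fun p hp => by
  refine ((hf.differentiableOn (by simp)).differentiableAt
    (hU.mem_nhds hp)).hasFDerivAt.congr_fderiv (ContinuousLinearMap.ext fun w => ?_)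
  have hw : w = w 0 • ![1, 0] + w 1 • ![0, 1] := by
    ext i
    fin_cases i <;> simp
  conv_lhs => rw [hw]
  rw [map_add, map_smul, map_smul, covector_apply]
  simp only [opX, partialY, smul_eq_mul]
  ring

lemma opX_partialY_comm (hU : IsOpen U) (hf : ContDiffOn ℝ ∞ f U) :
    EqOn (opX (partialY f)) (partialY (opX f)) U := fun p hp => by
  have hd : DifferentiableAt ℝ (fderiv ℝ f) p :=
    ((hf.fderiv_of_isOpen (m := ∞) hU (by simp)).differentiableOn (by simp)).differentiableAt
      (hU.mem_nhds hp)
  have happ : ∀ v w : Fin 2 → ℝ,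
      fderiv ℝ (fun q => fderiv ℝ f q v) p w = fderiv ℝ (fderiv ℝ f) p w v := fun v w => by
    rw [fderiv_clm_apply hd (differentiableAt_const v)]
    simp
  have hsymm : IsSymmSndFDerivAt ℝ f p :=
    (hf.contDiffAt (hU.mem_nhds hp)).isSymmSndFDerivAt
      (by simpa using WithTop.coe_le_coe.2 (le_top : (2 : ℕ∞) ≤ ⊤))
  exact ((happ _ _).trans (hsymm.eq _ _)).trans (happ _ _).symm

lemma opX_congr (hU : IsOpen U) (h : EqOn f g U) : EqOn (opX f) (opX g) U := fun p hp => by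
  simp only [opX, (h.eventuallyEq_of_mem (hU.mem_nhds hp)).fderiv_eq]

lemma partialY_congr (hU : IsOpen U) (h : EqOn f g U) : EqOn (partialY f) (partialY g) U :=
  fun p hp => by simp only [partialY, (h.eventuallyEq_of_mem (hU.mem_nhds hp)).fderiv_eq]

/-- A continuous function on an open set vanishes if it does so off the `y`-axis. -/
lemma eq_zero_of_fst_mul_eq_zero (hU : IsOpen U) (hf : ContinuousOn f U)
    (h : ∀ p ∈ U, p 0 * f p = 0) : ∀ p ∈ U, f p = 0 := by
  intro p hp
  by_contra hne
  have hnear : ∀ᶠ q in 𝓝 p, q ∈ U ∧ f q ≠ 0 :=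
    (hU.eventually_mem hp).and
      ((hf.continuousAt (hU.mem_nhds hp)).eventually_ne hne)
  have hline : ContinuousAt (fun t : ℝ => p + t • ![1, 0]) 0 := by fun_prop
  have hev := hline.eventually (by simpa only [zero_smul, add_zero] using hnear)
  have hzero : ∀ᶠ t : ℝ in 𝓝 0, p 0 + t = 0 := by
    filter_upwards [hev] with t ht
    have := (mul_eq_zero.1 (h _ ht.1)).resolve_right ht.2
    simpa using this
  obtain ⟨t, ht, ht'⟩ := ((hzero.filter_mono nhdsWithin_le_nhds).and
    (self_mem_nhdsWithin (s := {(0 : ℝ)}ᶜ))).exists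
  have h0 := hzero.self_of_nhds
  apply ht'
  simp only [mem_singleton_iff]
  linarith

end Partials

/-! ### Division by `x²` -/

section DivSq

/-- The quotient `h / x²`, extended to the `y`-axis by half the second `x`-derivative of `h`. -/
noncomputable def divSq (h : (Fin 2 → ℝ) → ℝ) : (Fin 2 → ℝ) → ℝ :=
  fun p => if p 0 = 0 then opX (opX h) p / 2 else h p / p 0 ^ 2

variable {U : Set (Fin 2 → ℝ)} {h v : (Fin 2 → ℝ) → ℝ}

lemma opX_eq_zero_of_euler (hU : IsOpen U) (hh : ContDiffOn ℝ ∞ h U) (hv : ContDiffOn ℝ ∞ v U)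
    (hrel : ∀ p ∈ U, p 0 * opX h p - 2 * h p = p 0 ^ 3 * v p) {p : Fin 2 → ℝ} (hp : p ∈ U)
    (hp0 : p 0 = 0) : opX h p = 0 := by
  have hl := (hasPartialsOn_fst.mul (hasPartialsOn_of_contDiffOn hU (hh.opX hU))).sub
    ((hasPartialsOn_const 2).mul (hasPartialsOn_of_contDiffOn hU hh))
  have hr := ((hasPartialsOn_fst_pow 3).mul (hasPartialsOn_of_contDiffOn hU hv)).congr hU hrel
  have := (hl.opX_eqOn hp).symm.trans (hr.opX_eqOn hp)
  simp only [hp0] at this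
  norm_num at this
  linarith

lemma euler_partialY (hU : IsOpen U) (hh : ContDiffOn ℝ ∞ h U) (hv : ContDiffOn ℝ ∞ v U)
    (hrel : ∀ p ∈ U, p 0 * opX h p - 2 * h p = p 0 ^ 3 * v p) :
    ∀ p ∈ U, p 0 * opX (partialY h) p - 2 * partialY h p = p 0 ^ 3 * partialY v p := by
  intro p hp
  have hl := (hasPartialsOn_fst.mul (hasPartialsOn_of_contDiffOn hU (hh.opX hU))).sub
    ((hasPartialsOn_const 2).mul (hasPartialsOn_of_contDiffOn hU hh))
  have hr := ((hasPartialsOn_fst_pow 3).mul (hasPartialsOn_of_contDiffOn hU hv)).congr hU hrel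
  have := (hl.partialY_eqOn hp).symm.trans (hr.partialY_eqOn hp)
  rw [opX_partialY_comm hU hh hp]
  linarith

lemma hasFDerivAt_divSq_of_ne (hU : IsOpen U) (hh : ContDiffOn ℝ ∞ h U)
    (hrel : ∀ p ∈ U, p 0 * opX h p - 2 * h p = p 0 ^ 3 * v p) {p : Fin 2 → ℝ} (hp : p ∈ U)
    (hp0 : p 0 ≠ 0) : HasFDerivAt (divSq h) (covector (v p) (divSq (partialY h) p)) p := by
  have hnear : divSq h =ᶠ[𝓝 p] fun q => h q / q 0 ^ 2 := by
    filter_upwards [(continuous_apply 0).continuousAt.eventually_ne hp0] with q hq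
    rw [divSq, if_neg hq]
  refine HasFDerivAt.congr_of_eventuallyEq ?_ hnear
  simp only [div_eq_mul_inv]
  refine ((hasPartialsOn_of_contDiffOn hU hh p hp).fun_mul
    ((hasDerivAt_inv (pow_ne_zero 2 hp0)).comp_hasFDerivAt p
      (hasPartialsOn_fst_pow (U := U) 2 p hp))).congr_fderiv ?_
  ext w
  have hvp : v p = (p 0 * opX h p - 2 * h p) / p 0 ^ 3 := by
    rw [hrel p hp]
    field_simp
  simp only [divSq, if_neg hp0, covector_apply, hvp]
  simp
  field_simp
  ring

lemma hasDerivAt_line (x y t : ℝ) :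
    HasDerivAt (fun t : ℝ => (![t * x, y] : Fin 2 → ℝ)) ![x, 0] t := by
  rw [hasDerivAt_pi]
  intro i
  fin_cases i
  · simpa using (hasDerivAt_id t).mul_const x
  · simpa using hasDerivAt_const t y

lemma HasPartialsOn.hasDerivAt_line {f fx fy : (Fin 2 → ℝ) → ℝ} (hf : HasPartialsOn U f fx fy)
    {x y t : ℝ} (ht : ![t * x, y] ∈ U) :
    HasDerivAt (fun t : ℝ => f ![t * x, y]) (x * fx ![t * x, y]) t := by
  refine (HasFDerivAt.comp_hasDerivAt t (hf _ ht) (_root_.hasDerivAt_line x y t)).congr_deriv ?_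
  simp [mul_comm]

lemma continuousAt_divSq_line (hU : IsOpen U) (hh : ContDiffOn ℝ ∞ h U)
    (hv : ContDiffOn ℝ ∞ v U) (hrel : ∀ p ∈ U, p 0 * opX h p - 2 * h p = p 0 ^ 3 * v p)
    {x y : ℝ} (hx : x ≠ 0) (hy : ![0, y] ∈ U) :
    ContinuousAt (fun t : ℝ => divSq h ![t * x, y]) 0 := by
  have hy' : ![0 * x, y] ∈ U := by rwa [zero_mul]
  have hline : ContinuousAt (fun t : ℝ => (![t * x, y] : Fin 2 → ℝ)) 0 :=
    (hasDerivAt_line x y 0).continuousAt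
  have hUline : ∀ᶠ t : ℝ in 𝓝[≠] 0, ![t * x, y] ∈ U :=
    (hline.eventually (hU.mem_nhds hy')).filter_mono nhdsWithin_le_nhds
  have hne : ∀ᶠ t : ℝ in 𝓝[≠] 0, t ≠ 0 := self_mem_nhdsWithin
  have hph := hasPartialsOn_of_contDiffOn hU hh
  have hphx := hasPartialsOn_of_contDiffOn hU (hh.opX hU)
  have hh0 : h ![0 * x, y] = 0 := by
    have := hrel _ hy'
    simp at this ⊢
    exact this
  have hhx0 : opX h ![0 * x, y] = 0 :=
    opX_eq_zero_of_euler hU hh hv hrel hy' (by simp)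
  rw [continuousAt_iff_punctured_nhds]
  have hderiv : Tendsto (fun t : ℝ => (x * opX h ![t * x, y]) / (2 * t * x ^ 2)) (𝓝[≠] 0)
      (𝓝 (divSq h ![0 * x, y])) := by
    have hs := (hasDerivAt_iff_tendsto_slope.1 (hphx.hasDerivAt_line hy')).const_mul (1 / (2 * x))
    have hval : divSq h ![0 * x, y] = 1 / (2 * x) * (x * opX (opX h) ![0 * x, y]) := by
      simp [divSq]
      field_simp
    rw [hval]
    refine hs.congr' ?_
    filter_upwards [hne] with t ht
    rw [slope_def_field, hhx0]
    field_simp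
    ring
  have hnum : Tendsto (fun t : ℝ => h ![t * x, y]) (𝓝[≠] 0) (𝓝 0) := by
    have := (hph.hasDerivAt_line hy').continuousAt.tendsto
    rw [hh0] at this
    exact this.mono_left nhdsWithin_le_nhds
  have hden : Tendsto (fun t : ℝ => t ^ 2 * x ^ 2) (𝓝[≠] 0) (𝓝 0) := by
    have : Continuous fun t : ℝ => t ^ 2 * x ^ 2 := by fun_prop
    simpa using (this.tendsto 0).mono_left nhdsWithin_le_nhds
  have hlim := HasDerivAt.lhopital_zero_nhdsNE
    (hUline.mono fun t ht => hph.hasDerivAt_line ht)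
    (Eventually.of_forall fun t => by simpa using (hasDerivAt_pow 2 t).mul_const (x ^ 2))
    (hne.mono fun t ht => by positivity) hnum hden hderiv
  refine hlim.congr' ?_
  filter_upwards [hne] with t ht
  have : t * x ≠ 0 := mul_ne_zero ht hx
  simp [divSq, ht, hx, mul_pow]

lemma exists_divSq_sub_eq (hU : IsOpen U) (hh : ContDiffOn ℝ ∞ h U)
    (hv : ContDiffOn ℝ ∞ v U) (hrel : ∀ p ∈ U, p 0 * opX h p - 2 * h p = p 0 ^ 3 * v p)
    {x y : ℝ} (hseg : ∀ t ∈ Icc (0 : ℝ) 1, ![t * x, y] ∈ U) :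
    ∃ t ∈ Icc (0 : ℝ) 1, divSq h ![x, y] - divSq h ![0, y] = x * v ![t * x, y] := by
  rcases eq_or_ne x 0 with rfl | hx
  · exact ⟨0, by simp, by simp⟩
  have hder : ∀ t ∈ Ioc (0 : ℝ) 1,
      HasDerivAt (fun t : ℝ => divSq h ![t * x, y]) (x * v ![t * x, y]) t := by
    intro t ht
    have hmem := hseg t (Ioc_subset_Icc_self ht)
    refine (HasFDerivAt.comp_hasDerivAt t (hasFDerivAt_divSq_of_ne hU hh hrel hmem
      (by simpa using ⟨ht.1.ne', hx⟩)) (hasDerivAt_line x y t)).congr_deriv ?_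
    simp [mul_comm]
  have hcont : ContinuousOn (fun t : ℝ => divSq h ![t * x, y]) (Icc 0 1) := by
    intro t ht
    rcases ht.1.eq_or_lt with rfl | hpos
    · exact (continuousAt_divSq_line hU hh hv hrel hx
        (by simpa using hseg 0 (by simp))).continuousWithinAt
    · exact (hder t ⟨hpos, ht.2⟩).continuousAt.continuousWithinAt
  obtain ⟨t, ht, heq⟩ := exists_hasDerivAt_eq_slope _ _ zero_lt_one hcont
    fun t ht => hder t (Ioo_subset_Ioc_self ht)
  exact ⟨t, Ioo_subset_Icc_self ht, by simpa using heq.symm⟩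

lemma hasFDerivAt_divSq_of_eq (hU : IsOpen U) (hh : ContDiffOn ℝ ∞ h U)
    (hv : ContDiffOn ℝ ∞ v U) (hrel : ∀ p ∈ U, p 0 * opX h p - 2 * h p = p 0 ^ 3 * v p)
    {p : Fin 2 → ℝ} (hp : p ∈ U) (hp0 : p 0 = 0) :
    HasFDerivAt (divSq h) (covector (v p) (divSq (partialY h) p)) p := by
  have hpeta : ∀ q : Fin 2 → ℝ, ![q 0, q 1] = q := fun q => by
    ext i
    fin_cases i <;> rfl
  have hpaxis : ![0, p 1] = p := by
    rw [← hp0, hpeta]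
  have haxis : HasFDerivAt (fun q : Fin 2 → ℝ => divSq h ![0, q 1])
      (covector 0 (divSq (partialY h) p)) p := by
    have hproj : HasFDerivAt (fun q : Fin 2 → ℝ => (![0, q 1] : Fin 2 → ℝ))
        (ContinuousLinearMap.pi
          ![0, ContinuousLinearMap.proj (R := ℝ) (φ := fun _ : Fin 2 => ℝ) 1]) p := by
      rw [hasFDerivAt_pi']
      intro i
      fin_cases i
      · exact hasFDerivAt_const 0 p
      · exact hasFDerivAt_apply 1 p
    have hxx := hasPartialsOn_of_contDiffOn hU ((hh.opX hU).opX hU) p hp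
    have hcomp := (HasFDerivAt.comp p (by rwa [hpaxis]) hproj).mul_const (1 / 2 : ℝ)
    refine (hcomp.congr_fderiv ?_).congr_of_eventuallyEq (Eventually.of_forall fun q => ?_)
    · have hcomm : opX (opX (partialY h)) p = partialY (opX (opX h)) p :=
        (opX_congr hU (opX_partialY_comm hU hh) hp).trans (opX_partialY_comm hU (hh.opX hU) hp)
      ext w
      simp [divSq, hp0, hcomm]
      ring
    · simp [divSq]
      ring
  have hrem : HasFDerivAt (fun q : Fin 2 → ℝ => divSq h q - divSq h ![0, q 1])
      (covector (v p) 0) p := by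
    rw [hasFDerivAt_iff_isLittleO, Asymptotics.isLittleO_iff]
    intro ε hε
    have hvnear := Metric.tendsto_nhds.1 (hv.continuousOn.continuousAt (hU.mem_nhds hp)) ε hε
    obtain ⟨r, hr, hball⟩ := Metric.eventually_nhds_iff_ball.1 ((hU.eventually_mem hp).and hvnear)
    filter_upwards [Metric.ball_mem_nhds p hr] with q hq
    have hseg : ∀ t ∈ Icc (0 : ℝ) 1, ![t * q 0, q 1] ∈ Metric.ball p r := by
      intro t ht
      refine lt_of_le_of_lt ((dist_pi_le_iff dist_nonneg).2 fun i => ?_) (Metric.mem_ball.1 hq)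
      refine le_trans ?_ (dist_le_pi_dist q p i)
      fin_cases i
      · simp only [Real.dist_eq, Fin.zero_eta, Matrix.cons_val_zero, hp0, sub_zero, abs_mul,
          abs_of_nonneg ht.1]
        exact mul_le_of_le_one_left (abs_nonneg _) ht.2
      · simp
    obtain ⟨t, ht, heq⟩ := exists_divSq_sub_eq hU hh hv hrel fun t ht => (hball _ (hseg t ht)).1
    have hvt := (hball _ (hseg t ht)).2
    rw [hpeta] at heq
    rw [heq, hpaxis, sub_self, sub_zero]
    have hq0 : |q 0| ≤ ‖q - p‖ := by
      simpa [hp0] using norm_le_pi_norm (q - p) 0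
    have hval : q 0 * v ![t * q 0, q 1] - covector (v p) 0 (q - p)
        = (v ![t * q 0, q 1] - v p) * q 0 := by
      simp [hp0]
      ring
    rw [hval, norm_mul, Real.norm_eq_abs (q 0)]
    rw [Real.dist_eq] at hvt
    exact mul_le_mul hvt.le hq0 (abs_nonneg _) hε.le
  have hsum := (hrem.fun_add haxis).congr_fderiv
    (g' := covector (v p) (divSq (partialY h) p)) (by ext w; simp)
  simpa using hsum

lemma hasPartialsOn_divSq (hU : IsOpen U) (hh : ContDiffOn ℝ ∞ h U) (hv : ContDiffOn ℝ ∞ v U)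
    (hrel : ∀ p ∈ U, p 0 * opX h p - 2 * h p = p 0 ^ 3 * v p) :
    HasPartialsOn U (divSq h) v (divSq (partialY h)) := fun p hp => by
  by_cases hp0 : p 0 = 0
  · exact hasFDerivAt_divSq_of_eq hU hh hv hrel hp hp0
  · exact hasFDerivAt_divSq_of_ne hU hh hrel hp hp0

lemma contDiffOn_divSq (hU : IsOpen U) (hh : ContDiffOn ℝ ∞ h U) (hv : ContDiffOn ℝ ∞ v U)
    (hrel : ∀ p ∈ U, p 0 * opX h p - 2 * h p = p 0 ^ 3 * v p) :
    ContDiffOn ℝ ∞ (divSq h) U := by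
  rw [contDiffOn_infty]
  intro n
  induction n generalizing h v with
  | zero =>
    exact contDiffOn_zero.2 fun p hp =>
      (hasPartialsOn_divSq hU hh hv hrel p hp).continuousAt.continuousWithinAt
  | succ n ih =>
    rw [Nat.cast_add, Nat.cast_one, contDiffOn_succ_iff_hasFDerivWithinAt_of_uniqueDiffOn
      hU.uniqueDiffOn]
    refine ⟨by simp, _, contDiffOn_covector (hv.of_le (mod_cast le_top))
      (ih (hh.partialY hU) (hv.partialY hU) (euler_partialY hU hh hv hrel)), fun p hp =>
      (hasPartialsOn_divSq hU hh hv hrel p hp).hasFDerivWithinAt⟩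

end DivSq

/-! ### Integrability -/

section Integrability

variable {U : Set (Fin 2 → ℝ)} {a b : (Fin 2 → ℝ) → ℝ}

lemma opX_opX_opY_add (hU : IsOpen U) (ha : ContDiffOn ℝ ∞ a U) {p : Fin 2 → ℝ} (hp : p ∈ U) :
    opX (opX (opY a)) p + opX (opZ a) p + opW a p =
      p 0 ^ 2 * opX (opX (partialY a)) p + 6 * p 0 * opX (partialY a) p + 6 * partialY a p := by
  have hv := hasPartialsOn_of_contDiffOn hU (ha.partialY hU)
  have hvx := hasPartialsOn_of_contDiffOn hU ((ha.partialY hU).opX hU)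
  have hY := (hasPartialsOn_fst_pow 2).mul hv
  have hYX := (((hasPartialsOn_const ((2 : ℕ) : ℝ)).mul (hasPartialsOn_fst_pow 1)).mul hv).add
    ((hasPartialsOn_fst_pow 2).mul hvx)
  have hZ := ((hasPartialsOn_const 2).mul hasPartialsOn_fst).mul hv
  rw [opW_eq, opZ_eq, opY_eq, hZ.opX_eqOn hp, opX_congr hU hY.opX_eqOn hp, hYX.opX_eqOn hp]
  push_cast
  ring

lemma opY_opY_eq (hU : IsOpen U) (ha : ContDiffOn ℝ ∞ a U) {p : Fin 2 → ℝ} (hp : p ∈ U) :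
    opY (opY a) p = p 0 ^ 4 * partialY (partialY a) p := by
  have hY := (hasPartialsOn_fst_pow 2).mul (hasPartialsOn_of_contDiffOn hU (ha.partialY hU))
  rw [opY_eq, opY_eq]
  simp only [hY.partialY_eqOn hp]
  ring

lemma equations_of_exists (hU : IsOpen U) (ha : ContDiffOn ℝ ∞ a U)
    {f : (Fin 2 → ℝ) → ℝ} {C D : ℝ} (hf : ContDiffOn ℝ ∞ f U)
    (hfa : ∀ p ∈ U, opX f p = a p) (hfb : ∀ p ∈ U, opY f p = C * p 0 + D + b p)
    {p : Fin 2 → ℝ} (hp : p ∈ U) :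
    opX (opX (opX b)) p = opX (opX (opY a)) p + opX (opZ a) p + opW a p ∧
      opY (opY a) p = opY (opX b) p - opZ b p := by
  have hu := hf.partialY hU
  have hpu := hasPartialsOn_of_contDiffOn hU hu
  have hpux := hasPartialsOn_of_contDiffOn hU (hu.opX hU)
  have hpuxx := hasPartialsOn_of_contDiffOn hU ((hu.opX hU).opX hU)
  have hpb := (((hasPartialsOn_fst_pow 2).mul hpu).sub
    (((hasPartialsOn_const C).mul hasPartialsOn_fst).add (hasPartialsOn_const D))).congr hU
    (g := b) fun q hq => by
      have := hfb q hq
      rw [opY_eq] at this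
      simp only at this ⊢
      linarith
  have hbx : EqOn (opX b) (fun q => 2 * q 0 * partialY f q + q 0 ^ 2 * opX (partialY f) q - C)
      U := fun q hq => by
    rw [hpb.opX_eqOn hq]
    norm_num
  have hpbx := (((((hasPartialsOn_const 2).mul hasPartialsOn_fst).mul hpu).add
    ((hasPartialsOn_fst_pow 2).mul hpux)).sub (hasPartialsOn_const C)).congr hU hbx
  have hbxx : EqOn (opX (opX b)) (fun q => 2 * partialY f q + 4 * q 0 * opX (partialY f) q
      + q 0 ^ 2 * opX (opX (partialY f)) q) U := fun q hq => by
    rw [hpbx.opX_eqOn hq]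
    norm_num
    ring
  have hpbxx := ((((hasPartialsOn_const 2).mul hpu).add
    (((hasPartialsOn_const 4).mul hasPartialsOn_fst).mul hpux)).add
    ((hasPartialsOn_fst_pow 2).mul hpuxx)).congr hU hbxx
  have hv : EqOn (partialY a) (opX (partialY f)) U := fun q hq =>
    (partialY_congr hU (fun r hr => (hfa r hr).symm) hq).trans (opX_partialY_comm hU hf hq).symm
  constructor
  · rw [opX_opX_opY_add hU ha hp, hpbxx.opX_eqOn hp, hv hp, opX_congr hU hv hp,
      opX_congr hU (opX_congr hU hv) hp]
    norm_num
    ring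
  · rw [opY_opY_eq hU ha hp, opY_eq, opZ_eq, partialY_congr hU hv hp]
    simp only [hpbx.partialY_eqOn hp, hpb.partialY_eqOn hp]
    ring

lemma exists_euler_of_equations (hU : IsOpen U) (hUc : IsPreconnected U)
    (ha : ContDiffOn ℝ ∞ a U) (hb : ContDiffOn ℝ ∞ b U)
    (hX : ∀ p ∈ U, opX (opX (opX b)) p = opX (opX (opY a)) p + opX (opZ a) p + opW a p)
    (hY : ∀ p ∈ U, opY (opY a) p = opY (opX b) p - opZ b p) :
    ∃ C D : ℝ, ∀ p ∈ U,
      p 0 * (opX b p + C) - 2 * (C * p 0 + D + b p) = p 0 ^ 3 * partialY a p := by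
  have hpb := hasPartialsOn_of_contDiffOn hU hb
  have hpbx := hasPartialsOn_of_contDiffOn hU (hb.opX hU)
  have hpbxx := hasPartialsOn_of_contDiffOn hU ((hb.opX hU).opX hU)
  have hpv := hasPartialsOn_of_contDiffOn hU (ha.partialY hU)
  have hpvx := hasPartialsOn_of_contDiffOn hU ((ha.partialY hU).opX hU)
  have hcoord : ContDiffOn ℝ ∞ (fun p : Fin 2 → ℝ => p 0) U := by fun_prop
  have hpg := ((hasPartialsOn_fst.mul hpbx).sub ((hasPartialsOn_const 2).mul hpb)).sub
    ((hasPartialsOn_fst_pow 3).mul hpv)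
  have hg : ContDiffOn ℝ ∞
      (fun p => p 0 * opX b p - 2 * b p - p 0 ^ 3 * partialY a p) U :=
    ((hcoord.mul (hb.opX hU)).sub (contDiffOn_const.mul hb)).sub
      ((hcoord.pow 3).mul (ha.partialY hU))
  have hgy := eq_zero_of_fst_mul_eq_zero hU (hg.partialY hU).continuousOn fun p hp => by
    have := hY p hp
    rw [opY_opY_eq hU ha hp, opY_eq, opZ_eq] at this
    rw [hpg.partialY_eqOn hp]
    linear_combination -this
  have hgx : EqOn (opX fun p => p 0 * opX b p - 2 * b p - p 0 ^ 3 * partialY a p)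
      (fun p => p 0 * opX (opX b) p - opX b p - (3 * p 0 ^ 2 * partialY a p
        + p 0 ^ 3 * opX (partialY a) p)) U := fun p hp => by
    rw [hpg.opX_eqOn hp]
    norm_num
    ring
  have hpgx := (((hasPartialsOn_fst.mul hpbxx).sub hpbx).sub
    ((((hasPartialsOn_const 3).mul (hasPartialsOn_fst_pow 2)).mul hpv).add
      ((hasPartialsOn_fst_pow 3).mul hpvx))).congr hU hgx
  obtain ⟨C, hC⟩ := (hasPartialsOn_of_contDiffOn hU (hg.opX hU)).exists_eq_const hU hUc
    (fun p hp => by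
      have := hX p hp
      rw [opX_opX_opY_add hU ha hp] at this
      rw [hpgx.opX_eqOn hp]
      norm_num
      linear_combination p 0 * this)
    (fun p hp => by
      rw [← opX_partialY_comm hU hg hp, opX_congr hU (g := fun _ => 0) hgy hp,
        (hasPartialsOn_const 0).opX_eqOn hp])
  obtain ⟨E, hE⟩ := ((hasPartialsOn_of_contDiffOn hU hg).sub
    ((hasPartialsOn_const C).mul hasPartialsOn_fst)).exists_eq_const hU hUc
    (fun p hp => by simp [hC p hp]) (fun p hp => by simp [hgy p hp])
  refine ⟨C, E / 2, fun p hp => ?_⟩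
  linear_combination hE p hp

lemma exists_primitive_of_partials (hU : IsOpen U) [ContractibleSpace U]
    {k : (Fin 2 → ℝ) → ℝ} (ha : ContDiffOn ℝ ∞ a U) (hk : ContDiffOn ℝ ∞ k U)
    (hak : EqOn (partialY a) (opX k) U) :
    ∃ f, ContDiffOn ℝ ∞ f U ∧ HasPartialsOn U f a k := by
  have hη := contDiffOn_covector ha hk
  have hd : DifferentiableOn ℝ (fun p => covector (a p) (k p)) U := hη.differentiableOn (by simp)
  have hη' : ∀ p ∈ U, ∀ v w, fderiv ℝ (fun p => covector (a p) (k p)) p v w =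
      covector (opX a p) (partialY a p) v * w 0 + covector (opX k p) (partialY k p) v * w 1 := by
    intro p hp v w
    have h := ((hasPartialsOn_of_contDiffOn hU ha p hp).smul_const
      (ContinuousLinearMap.proj (R := ℝ) (φ := fun _ : Fin 2 => ℝ) 0)).fun_add
      ((hasPartialsOn_of_contDiffOn hU hk p hp).smul_const
      (ContinuousLinearMap.proj (R := ℝ) (φ := fun _ : Fin 2 => ℝ) 1))
    have h' : fderiv ℝ (fun p => covector (a p) (k p)) p = _ := h.fderiv
    rw [h']
    simp
  obtain ⟨f, hf⟩ := exists_primitive_of_contractibleSpace (η := fun p => covector (a p) (k p))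
    hU fun p hp => by
      obtain ⟨r, hr, hball⟩ := Metric.isOpen_iff.1 hU p hp
      obtain ⟨φ, hφ⟩ := (convex_ball p r).exists_forall_hasFDerivAt_of_fderiv_symmetric
        Metric.isOpen_ball (hd.mono hball) fun q hq v w => by
          rw [hη' q (hball hq), hη' q (hball hq)]
          simp only [covector_apply, hak (hball hq)]
          ring
      exact ⟨φ, eventually_of_mem (Metric.ball_mem_nhds p hr) hφ⟩
  refine ⟨f, ?_, hf⟩
  rw [contDiffOn_infty_iff_fderiv_of_isOpen hU]
  exact ⟨fun p hp => (hf p hp).differentiableAt.differentiableWithinAt,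
    hη.congr fun p hp => (hf p hp).fderiv⟩

lemma fst_sq_mul_divSq {h v : (Fin 2 → ℝ) → ℝ}
    (hrel : ∀ p ∈ U, p 0 * opX h p - 2 * h p = p 0 ^ 3 * v p) {p : Fin 2 → ℝ} (hp : p ∈ U) :
    p 0 ^ 2 * divSq h p = h p := by
  by_cases hp0 : p 0 = 0
  · have := hrel p hp
    simp [hp0] at this
    simp [hp0, this]
  · rw [divSq, if_neg hp0]
    field_simp

end Integrability

theorem second_grushin_integrability
    (U : Set (Fin 2 → ℝ)) (hU : IsOpen U) (hUc : ContractibleSpace U)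
    (a b : (Fin 2 → ℝ) → ℝ)
    (ha : ContDiffOn ℝ (⊤ : ℕ∞) a U) (hb : ContDiffOn ℝ (⊤ : ℕ∞) b U) :
    (∀ p ∈ U, opX (opX (opX b)) p =
                opX (opX (opY a)) p + opX (opZ a) p + opW a p ∧
              opY (opY a) p = opY (opX b) p - opZ b p) ↔
    (∃ f : (Fin 2 → ℝ) → ℝ, ∃ C D : ℝ, ContDiffOn ℝ (⊤ : ℕ∞) f U ∧
      ∀ p ∈ U, opX f p = a p ∧ opY f p = C * p 0 + D + b p) := by
  constructor
  · intro heq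
    have hconn : IsPreconnected U := isPreconnected_iff_preconnectedSpace.2 inferInstance
    obtain ⟨C, D, hCD⟩ := exists_euler_of_equations hU hconn ha hb
      (fun p hp => (heq p hp).1) fun p hp => (heq p hp).2
    have hh : ContDiffOn ℝ ∞ (fun p => C * p 0 + D + b p) U :=
      ContDiffOn.add (by fun_prop) hb
    have hph := (((hasPartialsOn_const C).mul hasPartialsOn_fst).add (hasPartialsOn_const D)).add
      (hasPartialsOn_of_contDiffOn hU hb)
    have hrel : ∀ p ∈ U, p 0 * opX (fun p => C * p 0 + D + b p) p
        - 2 * (C * p 0 + D + b p) = p 0 ^ 3 * partialY a p := fun p hp => by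
      rw [hph.opX_eqOn hp, ← hCD p hp]
      ring
    have hv := ha.partialY hU
    obtain ⟨f, hf, hpf⟩ := exists_primitive_of_partials hU ha (contDiffOn_divSq hU hh hv hrel)
      (hasPartialsOn_divSq hU hh hv hrel).opX_eqOn.symm
    refine ⟨f, C, D, hf, fun p hp => ⟨hpf.opX_eqOn hp, ?_⟩⟩
    rw [opY_eq]
    simp only [hpf.partialY_eqOn hp]
    exact fst_sq_mul_divSq hrel hp
  · rintro ⟨f, C, D, hf, h⟩ p hp
    exact equations_of_exists hU ha hf (fun q hq => (h q hq).1) (fun q hq => (h q hq).2) hp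
end

section
/- Let U ⊆ ℝ² be a contractible open set. Then the second Grushin complex is exact at its final term: for every smooth function ρ : U → ℝ there exist smooth functions g, h : U → ℝ such that Xh − Yg = ρ on U. -/
open Set Filter Topology MeasureTheory
open scoped ContDiff

theorem hasFDerivAt_intervalIntegral_of_contDiff {E G : Type*}
    [NormedAddCommGroup E] [NormedSpace ℝ E] [ProperSpace E]
    [NormedAddCommGroup G] [NormedSpace ℝ G] [CompleteSpace G]
    {F : E × ℝ → G} (hF : ContDiff ℝ ∞ F) (a b : ℝ) (x₀ : E) :
    HasFDerivAt (fun x => ∫ t in a..b, F (x, t))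
      (∫ t in a..b, (fderiv ℝ F (x₀, t)).comp (ContinuousLinearMap.inl ℝ E ℝ)) x₀ := by
  have hF' : Continuous fun q : E × ℝ =>
      (fderiv ℝ F q).comp (ContinuousLinearMap.inl ℝ E ℝ) :=
    (hF.continuous_fderiv (by simp)).clm_comp continuous_const
  obtain ⟨C, hC⟩ := ((isCompact_closedBall x₀ 1).prod
    (isCompact_uIcc (a := a) (b := b))).exists_bound_of_continuousOn hF'.continuousOn
  refine intervalIntegral.hasFDerivAt_integral_of_dominated_of_fderiv_le (bound := fun _ => C)
    (F := fun x t => F (x, t))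
    (F' := fun x t => (fderiv ℝ F (x, t)).comp (ContinuousLinearMap.inl ℝ E ℝ))
    (Metric.closedBall_mem_nhds x₀ one_pos) ?_ ?_ ?_ ?_ ?_ ?_
  · exact Eventually.of_forall fun x =>
      (hF.continuous.comp (by fun_prop : Continuous fun t : ℝ => (x, t))).aestronglyMeasurable
  · exact (hF.continuous.comp
      (by fun_prop : Continuous fun t : ℝ => (x₀, t))).intervalIntegrable _ _
  · exact (hF'.comp (by fun_prop : Continuous fun t : ℝ => (x₀, t))).aestronglyMeasurable
  · exact Eventually.of_forall fun t ht x hx => hC (x, t) ⟨hx, uIoc_subset_uIcc ht⟩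
  · exact intervalIntegrable_const
  · refine Eventually.of_forall fun t _ x _ => ?_
    exact ((hF.differentiable (by simp)) (x, t)).hasFDerivAt.comp x (hasFDerivAt_prodMk_left x t)

theorem contDiff_intervalIntegral_param {E : Type} [NormedAddCommGroup E] [NormedSpace ℝ E]
    [ProperSpace E] (a b : ℝ) (n : ℕ) : ∀ {G : Type} [NormedAddCommGroup G] [NormedSpace ℝ G]
    [CompleteSpace G] {F : E × ℝ → G}, ContDiff ℝ ∞ F →
      ContDiff ℝ n (fun x => ∫ t in a..b, F (x, t)) := by
  induction n with
  | zero =>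
    intro G _ _ _ F hF
    exact contDiff_zero.2 (continuous_iff_continuousAt.2 fun x =>
      (hasFDerivAt_intervalIntegral_of_contDiff hF a b x).continuousAt)
  | succ n ih =>
    intro G _ _ _ F hF
    have hd := hasFDerivAt_intervalIntegral_of_contDiff hF a b
    rw [Nat.cast_succ]
    refine contDiff_succ_iff_fderiv.2 ⟨fun x => (hd x).differentiableAt, by simp, ?_⟩
    rw [funext fun x => (hd x).fderiv]
    exact ih ((contDiff_infty_iff_fderiv.1 hF).2.clm_comp contDiff_const)

theorem contDiff_primitive_param {E : Type} [NormedAddCommGroup E] [NormedSpace ℝ E]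
    [ProperSpace E] {F : E × ℝ → ℝ} (hF : ContDiff ℝ ∞ F) (a : ℝ) :
    ContDiff ℝ ∞ (fun q : E × ℝ => ∫ t in a..q.2, F (q.1, t)) := by
  have key : (fun q : E × ℝ => ∫ t in a..q.2, F (q.1, t)) =
      fun q : E × ℝ => (q.2 - a) * ∫ s in (0 : ℝ)..1, F (q.1, a + (q.2 - a) * s) := by
    funext q
    have := intervalIntegral.smul_integral_comp_add_mul (a := 0) (b := 1)
      (fun t => F (q.1, t)) (q.2 - a) a
    simpa using this.symm
  rw [key]
  refine (contDiff_snd.sub contDiff_const).mul (contDiff_infty.2 fun n => ?_)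
  exact contDiff_intervalIntegral_param 0 1 n
    (F := fun z : (E × ℝ) × ℝ => F (z.1.1, a + (z.1.2 - a) * z.2))
    (hF.comp (by fun_prop))

theorem opX_eq_of_hasDerivAt {f : (Fin 2 → ℝ) → ℝ} {p : Fin 2 → ℝ} {d : ℝ}
    (hf : DifferentiableAt ℝ f p) (hd : HasDerivAt (fun s => f ![s, p 1]) d (p 0)) :
    opX f p = d := by
  have hp : p = ![p 0, p 1] := by ext i; fin_cases i <;> rfl
  have hl : HasDerivAt (fun s : ℝ => ![s, p 1]) ![1, 0] (p 0) := by
    refine hasDerivAt_pi.2 fun i => ?_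
    fin_cases i
    · exact hasDerivAt_id _
    · exact hasDerivAt_const _ _
  rw [hp] at hf
  have h := hf.hasFDerivAt.comp_hasDerivAt (p 0) hl
  rw [← hp] at h
  exact h.unique hd

theorem opY_eq_of_hasDerivAt {f : (Fin 2 → ℝ) → ℝ} {p : Fin 2 → ℝ} {d : ℝ}
    (hf : DifferentiableAt ℝ f p) (hd : HasDerivAt (fun s => f ![p 0, s]) d (p 1)) :
    opY f p = p 0 ^ 2 * d := by
  have hp : p = ![p 0, p 1] := by ext i; fin_cases i <;> rfl
  have hl : HasDerivAt (fun s : ℝ => ![p 0, s]) ![0, 1] (p 1) := by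
    refine hasDerivAt_pi.2 fun i => ?_
    fin_cases i
    · exact hasDerivAt_const _ _
    · exact hasDerivAt_id _
  rw [hp] at hf
  have h := hf.hasFDerivAt.comp_hasDerivAt (p 1) hl
  rw [← hp] at h
  have hv : (![0, p 0 ^ 2] : Fin 2 → ℝ) = (p 0 ^ 2) • ![0, 1] := by
    ext i; fin_cases i <;> simp
  rw [opY, hv, map_smul, h.unique hd, smul_eq_mul]

theorem exists_weighted_bump {a b : ℝ} (hab : a < b) :
    ∃ η : ℝ → ℝ, ContDiff ℝ ∞ η ∧ (∀ t, t ∉ Ioo a b → η t = 0) ∧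
      ∫ t in a..b, t ^ 2 * η t = 1 := by
  obtain ⟨β, hs, hβ, hr⟩ := (isOpen_Ioo (a := a) (b := b)).exists_contDiff_support_eq (n := ⊤)
  have h0 : ∀ t, 0 ≤ β t := fun t => (hr (mem_range_self t)).1
  have hpos : 0 < ∫ t in a..b, t ^ 2 * β t := by
    obtain ⟨c, hc, hc0⟩ : ∃ c ∈ Ioo a b, c ≠ 0 :=
      ((Ioo_infinite hab).sdiff (finite_singleton (0 : ℝ))).nonempty
    refine intervalIntegral.integral_pos hab
      ((continuous_pow 2).mul hβ.continuous).continuousOn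
      (fun t _ => mul_nonneg (sq_nonneg t) (h0 t)) ⟨c, Ioo_subset_Icc_self hc, ?_⟩
    have : β c ≠ 0 := by rw [← Function.mem_support, hs]; exact hc
    have := (h0 c).lt_of_ne' this
    positivity
  refine ⟨fun t => β t / ∫ t in a..b, t ^ 2 * β t, hβ.div_const _, fun t ht => ?_, ?_⟩
  · rw [← hs, Function.notMem_support] at ht
    simp [ht]
  · simp_rw [← mul_div_assoc]
    rw [intervalIntegral.integral_div, div_self hpos.ne']

theorem intervalIntegral_eq_zero_of_notMem_Ioo {a b : ℝ} {φ : ℝ → ℝ}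
    (hφ : Continuous φ) (hs : ∀ t, t ∉ Ioo a b → φ t = 0) (hI : ∫ t in a..b, φ t = 0)
    {x : ℝ} (hx : x ∉ Ioo a b) : ∫ t in a..x, φ t = 0 := by
  have hz : ∀ e, (∀ s ∈ uIcc e x, s ∉ Ioo a b) → ∫ t in e..x, φ t = 0 := fun e he =>
    (intervalIntegral.integral_congr (g := fun _ => 0) fun s h => hs s (he s h)).trans (by simp)
  rcases le_or_gt x a with h | h
  · refine hz a fun s h1 h2 => ?_
    rw [uIcc_of_ge h] at h1
    exact h2.1.not_ge h1.2
  · have hb : b ≤ x := not_lt.1 fun h' => hx ⟨h, h'⟩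
    rw [← intervalIntegral.integral_add_adjacent_intervals (b := b)
      (hφ.intervalIntegrable _ _) (hφ.intervalIntegrable _ _), hI, zero_add]
    refine hz b fun s h1 h2 => ?_
    rw [uIcc_of_le hb] at h1
    exact h2.2.not_ge h1.1

theorem exists_opX_sub_opY_of_integral_eq_zero {a b c d : ℝ} (hab : a < b)
    {f : (Fin 2 → ℝ) → ℝ} (hf : ContDiff ℝ ∞ f)
    (hs : ∀ p, ¬ (p 0 ∈ Ioo a b ∧ p 1 ∈ Ioo c d) → f p = 0)
    (hI : ∫ y in c..d, ∫ x in a..b, f ![x, y] = 0) :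
    ∃ g h : (Fin 2 → ℝ) → ℝ, ContDiff ℝ ∞ g ∧ ContDiff ℝ ∞ h ∧
      (∀ p, ¬ (p 0 ∈ Ioo a b ∧ p 1 ∈ Ioo c d) → g p = 0) ∧
      (∀ p, ¬ (p 0 ∈ Ioo a b ∧ p 1 ∈ Ioo c d) → h p = 0) ∧
      ∀ p, opX h p - opY g p = f p := by
  obtain ⟨η, hη, hηs, hηI⟩ := exists_weighted_bump hab
  set m : ℝ → ℝ := fun y => ∫ x in a..b, f ![x, y] with hm
  have hvec : ContDiff ℝ ∞ fun q : ℝ × ℝ => (![q.2, q.1] : Fin 2 → ℝ) := by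
    refine contDiff_pi.2 fun i => ?_
    fin_cases i
    · exact contDiff_snd
    · exact contDiff_fst
  have hF : ContDiff ℝ ∞ fun q : ℝ × ℝ => f ![q.2, q.1] := hf.comp hvec
  have hmc : ContDiff ℝ ∞ m :=
    (contDiff_primitive_param hF a).comp (contDiff_id.prodMk contDiff_const)
  have hH : ContDiff ℝ ∞ fun q : ℝ × ℝ => f ![q.2, q.1] - q.2 ^ 2 * η q.2 * m q.1 :=
    hF.sub (((contDiff_snd.pow 2).mul (hη.comp contDiff_snd)).mul (hmc.comp contDiff_fst))
  have hfx : ∀ x y, x ∉ Ioo a b → f ![x, y] = 0 := fun x y hx => hs _ fun h => hx h.1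
  have hfy : ∀ x y, y ∉ Ioo c d → f ![x, y] = 0 := fun x y hy => hs _ fun h => hy h.2
  have hmy : ∀ y, y ∉ Ioo c d → m y = 0 := fun y hy => by simp [hm, hfy _ y hy]
  set M : ℝ → ℝ := fun y => ∫ s in c..y, m s
  have hMc : ContDiff ℝ ∞ M :=
    (contDiff_primitive_param (hmc.comp (contDiff_snd (E := ℝ))) c).comp
      ((contDiff_const (c := (0 : ℝ))).prodMk contDiff_id)
  have hMy : ∀ y, y ∉ Ioo c d → M y = 0 := fun y hy =>
    intervalIntegral_eq_zero_of_notMem_Ioo hmc.continuous hmy hI hy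
  have hev : ContDiff ℝ ∞ fun p : Fin 2 → ℝ => (p 1, p 0) :=
    (contDiff_apply ℝ ℝ 1).prodMk (contDiff_apply ℝ ℝ 0)
  have hgc : ContDiff ℝ ∞ fun p : Fin 2 → ℝ => -(η (p 0) * M (p 1)) :=
    ((hη.comp (contDiff_apply ℝ ℝ 0)).mul (hMc.comp (contDiff_apply ℝ ℝ 1))).neg
  have hhc : ContDiff ℝ ∞ fun p : Fin 2 → ℝ =>
      ∫ t in a..p 0, (f ![t, p 1] - t ^ 2 * η t * m (p 1)) :=
    (contDiff_primitive_param hH a).comp hev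
  have hcont : ∀ y, Continuous fun t => f ![t, y] - t ^ 2 * η t * m y := fun y =>
    hH.continuous.comp (by fun_prop : Continuous fun t : ℝ => (y, t))
  refine ⟨_, _, hgc, hhc, ?_, ?_, ?_⟩
  · intro p hp
    by_cases h : p 0 ∈ Ioo a b
    · simp [hMy _ fun h' => hp ⟨h, h'⟩]
    · simp [hηs _ h]
  · intro p hp
    by_cases h : p 1 ∈ Ioo c d
    · refine intervalIntegral_eq_zero_of_notMem_Ioo (hcont _)
        (fun t ht => by simp [hfx _ _ ht, hηs _ ht]) ?_ fun h' => hp ⟨h', h⟩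
      rw [intervalIntegral.integral_sub, intervalIntegral.integral_mul_const, hηI, one_mul,
        sub_self]
      · exact (hF.continuous.comp
          (by fun_prop : Continuous fun t : ℝ => (p 1, t))).intervalIntegrable _ _
      · exact (((continuous_pow 2).mul hη.continuous).mul
          continuous_const).intervalIntegrable _ _
    · simp [hfy _ _ h, hmy _ h]
  · intro p
    have hp : ![p 0, p 1] = p := by ext i; fin_cases i <;> rfl
    rw [opX_eq_of_hasDerivAt (hhc.differentiable (by simp) p)
        ((hcont (p 1)).integral_hasStrictDerivAt a (p 0)).hasDerivAt,
      opY_eq_of_hasDerivAt (hgc.differentiable (by simp) p)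
        ((hmc.continuous.integral_hasStrictDerivAt c (p 1)).hasDerivAt.const_mul (η (p 0))).neg,
      hp]
    ring

theorem integral_fin_two_eq_intervalIntegral {a b c d : ℝ} (hab : a ≤ b) (hcd : c ≤ d)
    {f : (Fin 2 → ℝ) → ℝ} (hf : Integrable f)
    (hs : ∀ p, ¬ (p 0 ∈ Ioo a b ∧ p 1 ∈ Ioo c d) → f p = 0) :
    ∫ p, f p = ∫ y in c..d, ∫ x in a..b, f ![x, y] := by
  have hv := (volume_preserving_finTwoArrow ℝ).symm
  have hint : Integrable (fun q : ℝ × ℝ => f ![q.1, q.2]) (volume.prod volume) :=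
    (hv.integrable_comp_emb (MeasurableEquiv.measurableEmbedding _)).2 hf
  have h1 : ∫ p, f p = ∫ q : ℝ × ℝ, f ![q.1, q.2] :=
    (hv.integral_comp (MeasurableEquiv.measurableEmbedding _) f).symm
  rw [h1, Measure.volume_eq_prod, integral_prod_symm _ hint]
  have hx : ∀ y, ∫ x, f ![x, y] = ∫ x in a..b, f ![x, y] := fun y => by
    rw [intervalIntegral.integral_of_le hab, setIntegral_eq_integral_of_forall_compl_eq_zero]
    exact fun x hx => hs _ fun h => hx (Ioo_subset_Ioc_self h.1)
  simp_rw [hx]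
  rw [intervalIntegral.integral_of_le hcd, setIntegral_eq_integral_of_forall_compl_eq_zero]
  intro y hy
  have : ∀ x, f ![x, y] = 0 := fun x => hs _ fun h => hy (Ioo_subset_Ioc_self h.2)
  simp [this]

theorem mem_ball_fin_two {c p : Fin 2 → ℝ} {r : ℝ} (hr : 0 < r) :
    p ∈ Metric.ball c r ↔
      p 0 ∈ Ioo (c 0 - r) (c 0 + r) ∧ p 1 ∈ Ioo (c 1 - r) (c 1 + r) := by
  simp only [Metric.mem_ball, dist_pi_lt_iff hr, Fin.forall_fin_two, ← Real.ball_eq_Ioo]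

theorem integrable_of_continuous_of_support_subset_ball {f : (Fin 2 → ℝ) → ℝ} (hf : Continuous f)
    {c : Fin 2 → ℝ} {r : ℝ} (hs : Function.support f ⊆ Metric.ball c r) : Integrable f :=
  hf.integrable_of_hasCompactSupport
    (.of_support_subset_isCompact (isCompact_closedBall c r)
      (hs.trans Metric.ball_subset_closedBall))

theorem exists_opX_sub_opY_of_support_subset_ball {c : Fin 2 → ℝ} {r : ℝ} (hr : 0 < r)
    {f : (Fin 2 → ℝ) → ℝ} (hf : ContDiff ℝ ∞ f) (hs : Function.support f ⊆ Metric.ball c r)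
    (hI : ∫ p, f p = 0) :
    ∃ g h : (Fin 2 → ℝ) → ℝ, ContDiff ℝ ∞ g ∧ ContDiff ℝ ∞ h ∧
      Function.support g ⊆ Metric.ball c r ∧ Function.support h ⊆ Metric.ball c r ∧
      ∀ p, opX h p - opY g p = f p := by
  have hs' : ∀ p, ¬ (p 0 ∈ Ioo (c 0 - r) (c 0 + r) ∧ p 1 ∈ Ioo (c 1 - r) (c 1 + r)) →
      f p = 0 := fun p hp => by
    rw [← mem_ball_fin_two hr] at hp
    exact Function.notMem_support.1 fun h => hp (hs h)
  rw [integral_fin_two_eq_intervalIntegral (by linarith) (by linarith)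
    (integrable_of_continuous_of_support_subset_ball hf.continuous hs) hs'] at hI
  obtain ⟨g, h, hg, hh, hgs, hhs, heq⟩ :=
    exists_opX_sub_opY_of_integral_eq_zero (by linarith) hf hs' hI
  refine ⟨g, h, hg, hh, fun p hp => ?_, fun p hp => ?_, heq⟩
  · exact (mem_ball_fin_two hr).2 (by_contra fun h' => hp (hgs p h'))
  · exact (mem_ball_fin_two hr).2 (by_contra fun h' => hp (hhs p h'))

theorem exists_contDiff_support_subset_integral_eq_one {V : Set (Fin 2 → ℝ)} (hV : IsOpen V)
    {c : Fin 2 → ℝ} {r : ℝ} (hVb : V ⊆ Metric.ball c r) :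
    ∃ β : (Fin 2 → ℝ) → ℝ, ContDiff ℝ ∞ β ∧ Function.support β ⊆ V ∧
      (V.Nonempty → ∫ p, β p = 1) := by
  obtain ⟨β, hs, hβ, hr⟩ := hV.exists_contDiff_support_eq (n := ⊤)
  refine ⟨fun p => β p / ∫ p, β p, hβ.div_const _, fun p hp => ?_, fun hne => ?_⟩
  · rw [← hs]
    exact fun h => hp (by simp [h])
  · have hpos : 0 < ∫ p, β p := by
      rw [integral_pos_iff_support_of_nonneg (fun p => (hr (mem_range_self p)).1)
        (integrable_of_continuous_of_support_subset_ball hβ.continuous (hs.trans_subset hVb)), hs]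
      exact hV.measure_pos volume hne
    rw [integral_div, div_self hpos.ne']

/-- On a locally finite graph without finitely supported locally constant functions,
every function on the vertices is the divergence of a flow along the edges. -/
theorem exists_flow_of_divergence {ι : Type*} (N : ι → Finset ι)
    (hN : ∀ i j, j ∈ N i → i ∈ N j)
    (hinj : ∀ f : ι →₀ ℝ, (∀ i, ∀ j ∈ N i, f i = f j) → f = 0) (m : ι → ℝ) :
    ∃ F : ι → ι → ℝ, ∀ i, ∑ j ∈ N i, (F i j - F j i) = m i := by
  classical
  set v : ι → (ι × ι →₀ ℝ) := fun i =>
    ∑ j ∈ N i, (Finsupp.single (i, j) 1 - Finsupp.single (j, i) 1) with hv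
  have hval : ∀ k i j, j ∈ N i →
      v k (i, j) = (if k = i then 1 else 0) - (if k = j then 1 else 0) := by
    intro k i j hij
    have hji := hN i j hij
    simp only [hv, Finsupp.finsetSum_apply, Finsupp.sub_apply, Finsupp.single_apply,
      Prod.mk.injEq, Finset.sum_sub_distrib]
    congr 1
    · by_cases h : k = i
      · subst h; simp [hij]
      · simp [h]
    · by_cases h : k = j
      · subst h; simp [hji]
      · simp [h]
  have hinj' : Function.Injective (Finsupp.linearCombination ℝ v) := by
    rw [← LinearMap.ker_eq_bot, LinearMap.ker_eq_bot']
    intro f hf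
    refine hinj f fun i j hij => sub_eq_zero.1 ?_
    have h0 := DFunLike.congr_fun hf (i, j)
    simp only [Finsupp.linearCombination_apply, Finsupp.sum, Finsupp.finsetSum_apply,
      Finsupp.smul_apply, hval _ i j hij, smul_eq_mul, mul_sub, Finset.sum_sub_distrib, mul_ite,
      mul_one, mul_zero, Finset.sum_ite_eq', Finsupp.mem_support_iff, ne_eq, ite_not,
      Finsupp.coe_zero, Pi.zero_apply] at h0
    rw [← h0]
    congr 1 <;> split_ifs with h <;> simp [h]
  obtain ⟨Φ, hΦ⟩ := LinearMap.dualMap_surjective_of_injective hinj'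
    (Finsupp.linearCombination ℝ m)
  refine ⟨fun i j => Φ (Finsupp.single (i, j) 1), fun i => ?_⟩
  have h := LinearMap.congr_fun hΦ (Finsupp.single i 1)
  simpa [hv, map_sum] using h

theorem exists_locallyFinite_ball_cover.{u} {E : Type u} [MetricSpace E] [ProperSpace E]
    {U : Set E} (hU : IsOpen U) :
    ∃ (ι : Type u) (c : ι → E) (r : ι → ℝ),
      (∀ i, 0 < r i) ∧ (∀ i, Metric.closedBall (c i) (r i) ⊆ U) ∧
      (∀ p ∈ U, ∃ i, p ∈ Metric.ball (c i) (r i)) ∧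
      ∀ K ⊆ U, IsCompact K → {i | (Metric.ball (c i) (r i) ∩ K).Nonempty}.Finite := by
  have : LocallyCompactSpace U := hU.locallyCompactSpace
  have hB : ∀ x : U, (𝓝 x).HasBasis
      (fun r : ℝ => 0 < r ∧ Metric.closedBall (x : E) r ⊆ U)
      (fun r => Subtype.val ⁻¹' Metric.ball (x : E) r) := by
    intro x
    obtain ⟨ε, hε, hεU⟩ := Metric.nhds_basis_closedBall.mem_iff.1 (hU.mem_nhds x.2)
    rw [nhds_subtype]
    refine ((Metric.nhds_basis_ball (x := (x : E))).comap Subtype.val).restrict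
      fun r hr => ⟨min r ε, lt_min hr hε, ?_, ?_⟩
    · exact (Metric.closedBall_subset_closedBall (min_le_right _ _)).trans hεU
    · exact preimage_mono (Metric.ball_subset_ball (min_le_left _ _))
  obtain ⟨ι, c, r, hr, hcov, hfin⟩ :=
    refinement_of_locallyCompact_sigmaCompact_of_nhds_basis hB
  refine ⟨ι, fun i => c i, r, fun i => (hr i).1, fun i => (hr i).2, fun p hp => ?_,
    fun K hKU hK => ?_⟩
  · obtain ⟨i, hi⟩ := mem_iUnion.1 (hcov.symm.subset (mem_univ (⟨p, hp⟩ : U)))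
    exact ⟨i, hi⟩
  · have hK' : IsCompact (Subtype.val ⁻¹' K : Set U) :=
      Topology.IsInducing.subtypeVal.isCompact_preimage' hK (by simpa using hKU)
    refine (hfin.finite_nonempty_inter_compact hK').subset ?_
    rintro i ⟨p, hp, hpK⟩
    exact ⟨⟨p, hKU hpK⟩, hp, hpK⟩

theorem eq_zero_of_locally_constant_on_open_cover {E ι : Type*} [TopologicalSpace E] [T2Space E]
    [PreconnectedSpace E] [NoncompactSpace E] {U : Set E} {Q K : ι → Set E}
    (hQ : ∀ i, IsOpen (Q i)) (hne : ∀ i, (Q i).Nonempty) (hK : ∀ i, IsCompact (K i))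
    (hQK : ∀ i, Q i ⊆ K i) (hKU : ∀ i, K i ⊆ U) (hcov : U ⊆ ⋃ i, Q i)
    {f : ι →₀ ℝ} (hf : ∀ i j, (Q i ∩ Q j).Nonempty → f i = f j) : f = 0 := by
  set A : Set E := ⋃ i ∈ f.support, Q i with hA
  set L : Set E := ⋃ i ∈ f.support, K i with hL
  have hLc : IsCompact L := f.support.isCompact_biUnion fun i _ => hK i
  have hAo : IsOpen A := isOpen_biUnion fun i _ => hQ i
  have hAeq : A = L \ ⋃ i ∈ (f.support : Set ι)ᶜ, Q i := by
    ext p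
    simp only [hA, hL, Set.mem_sdiff, mem_iUnion, exists_prop, not_exists, not_and,
      Finset.mem_coe, mem_compl_iff, Finsupp.mem_support_iff, not_not]
    constructor
    · rintro ⟨i, hi, hp⟩
      exact ⟨⟨i, hi, hQK i hp⟩, fun j hj hpj => hi ((hf i j ⟨p, hp, hpj⟩).trans hj)⟩
    · rintro ⟨⟨i, _, hp⟩, h⟩
      obtain ⟨j, hj⟩ := mem_iUnion.1 (hcov (hKU i hp))
      exact ⟨j, fun h0 => h j h0 hj, hj⟩
  have hAc : IsCompact A := hAeq ▸ hLc.diff (isOpen_biUnion fun i _ => hQ i)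
  have hA0 : A = ∅ := (isClopen_iff.1 ⟨hAc.isClosed, hAo⟩).resolve_right hAc.ne_univ
  ext i
  by_contra hi
  obtain ⟨p, hp⟩ := hne i
  exact (hA0 ▸ mem_biUnion (Finsupp.mem_support_iff.2 hi) hp : p ∈ (∅ : Set E))

theorem finsum_eventuallyEq_sum {E ι : Type*} [TopologicalSpace E] {Q : ι → Set E}
    {u : ι → E → ℝ} (hu : ∀ i, Function.support (u i) ⊆ Q i) {p : E} {S : Finset ι}
    (hS : ∀ᶠ q in 𝓝 p, ∀ i, q ∈ Q i → i ∈ S) :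
    (fun q => ∑ᶠ i, u i q) =ᶠ[𝓝 p] fun q => ∑ i ∈ S, u i q := by
  filter_upwards [hS] with q hq
  exact finsum_eq_sum_of_support_subset _ fun i hi => hq i (hu i hi)

theorem contDiffAt_finsum {E ι : Type*} [NormedAddCommGroup E] [NormedSpace ℝ E] {Q : ι → Set E}
    {u : ι → E → ℝ} (hu : ∀ i, Function.support (u i) ⊆ Q i) (hc : ∀ i, ContDiff ℝ ∞ (u i))
    {p : E} {S : Finset ι} (hS : ∀ᶠ q in 𝓝 p, ∀ i, q ∈ Q i → i ∈ S) :
    ContDiffAt ℝ ∞ (fun q => ∑ᶠ i, u i q) p :=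
  (ContDiff.sum fun i _ => hc i).contDiffAt.congr_of_eventuallyEq (finsum_eventuallyEq_sum hu hS)

theorem fderiv_finsum {E ι : Type*} [NormedAddCommGroup E] [NormedSpace ℝ E] {Q : ι → Set E}
    {u : ι → E → ℝ} (hu : ∀ i, Function.support (u i) ⊆ Q i) (hc : ∀ i, ContDiff ℝ ∞ (u i))
    {p : E} {S : Finset ι} (hS : ∀ᶠ q in 𝓝 p, ∀ i, q ∈ Q i → i ∈ S) :
    fderiv ℝ (fun q => ∑ᶠ i, u i q) p = ∑ i ∈ S, fderiv ℝ (u i) p := by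
  rw [(finsum_eventuallyEq_sum hu hS).fderiv_eq, fderiv_fun_sum]
  exact fun i _ => (hc i).differentiable (by simp) p

/-- A function that is smooth on an open set decomposes along a locally finite ball cover. -/
theorem exists_contDiff_decomposition {E ι : Type*} [NormedAddCommGroup E] [NormedSpace ℝ E]
    [FiniteDimensional ℝ E] {U : Set E} (hU : IsOpen U) {c : ι → E} {r : ι → ℝ}
    (hrU : ∀ i, Metric.closedBall (c i) (r i) ⊆ U)
    (hcov : ∀ p ∈ U, ∃ i, p ∈ Metric.ball (c i) (r i))
    (hfin : ∀ p ∈ U, ∃ S : Finset ι, ∀ᶠ q in 𝓝 p, ∀ i, q ∈ Metric.ball (c i) (r i) → i ∈ S)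
    {ρ : E → ℝ} (hρ : ContDiffOn ℝ ∞ ρ U) :
    ∃ u : ι → E → ℝ, (∀ i, ContDiff ℝ ∞ (u i)) ∧
      (∀ i, Function.support (u i) ⊆ Metric.ball (c i) (r i)) ∧
      ∀ p ∈ U, ∑ᶠ i, u i p = ρ p := by
  choose β hβs hβ hβr using fun i =>
    (Metric.isOpen_ball (x := c i) (ε := r i)).exists_contDiff_support_eq (n := ⊤)
  set σ : E → ℝ := fun q => ∑ᶠ i, β i q
  have hsupp : ∀ i, Function.support (β i) ⊆ Metric.ball (c i) (r i) := fun i => (hβs i).subset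
  have hfinite : ∀ p ∈ U, (Function.support fun i => β i p).Finite := fun p hp => by
    obtain ⟨S, hS⟩ := hfin p hp
    exact S.finite_toSet.subset fun i hi => hS.self_of_nhds i (hsupp i hi)
  have hσpos : ∀ p ∈ U, σ p ≠ 0 := fun p hp => by
    obtain ⟨i, hi⟩ := hcov p hp
    rw [← hβs i] at hi
    have h0 : ∀ j, 0 ≤ β j p := fun j => (hβr j (mem_range_self p)).1
    exact (((h0 i).lt_of_ne' hi).trans_le (single_le_finsum i (hfinite p hp) h0)).ne'
  have hσc : ∀ p ∈ U, ContDiffAt ℝ ∞ σ p := fun p hp => by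
    obtain ⟨S, hS⟩ := hfin p hp
    exact contDiffAt_finsum hsupp hβ hS
  refine ⟨fun i q => β i q * (ρ q / σ q), fun i => contDiff_iff_contDiffAt.2 fun p => ?_,
    fun i p hp => hsupp i (left_ne_zero_of_mul hp), fun p hp => ?_⟩
  · by_cases hp : p ∈ Metric.closedBall (c i) (r i)
    · have hpU := hrU i hp
      exact (hβ i).contDiffAt.mul
        ((hρ.contDiffAt (hU.mem_nhds hpU)).div (hσc p hpU) (hσpos p hpU))
    · refine (contDiffAt_const (c := (0 : ℝ))).congr_of_eventuallyEq ?_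
      filter_upwards [Metric.isClosed_closedBall.isOpen_compl.mem_nhds hp] with q hq
      have : β i q = 0 := Function.notMem_support.1 fun h =>
        hq (Metric.ball_subset_closedBall (hsupp i h))
      rw [this, zero_mul]
  · rw [← finsum_mul' _ _ (hfinite p hp), mul_div_cancel₀ _ (hσpos p hp)]

theorem second_grushin_exact_final
    (U : Set (Fin 2 → ℝ)) (hU : IsOpen U) (hUc : ContractibleSpace U)
    (ρ : (Fin 2 → ℝ) → ℝ) (hρ : ContDiffOn ℝ (⊤ : ℕ∞) ρ U) :
    ∃ g h : (Fin 2 → ℝ) → ℝ, ContDiffOn ℝ (⊤ : ℕ∞) g U ∧ ContDiffOn ℝ (⊤ : ℕ∞) h U ∧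
      ∀ p ∈ U, opX h p - opY g p = ρ p := by
  classical
  obtain ⟨ι, c, r, hr, hrU, hcov, hfin⟩ := exists_locallyFinite_ball_cover hU
  set Q : ι → Set (Fin 2 → ℝ) := fun i => Metric.ball (c i) (r i)
  have hloc : ∀ p ∈ U, ∃ S : Finset ι, ∀ᶠ q in 𝓝 p, ∀ i, q ∈ Q i → i ∈ S := fun p hp => by
    obtain ⟨ε, hε, hεU⟩ := Metric.nhds_basis_closedBall.mem_iff.1 (hU.mem_nhds hp)
    refine ⟨(hfin _ hεU (isCompact_closedBall p ε)).toFinset, ?_⟩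
    filter_upwards [Metric.closedBall_mem_nhds p hε] with q hq i hi
    exact (Finite.mem_toFinset _).2 ⟨q, hi, hq⟩
  obtain ⟨u, hu, hus, huρ⟩ := exists_contDiff_decomposition hU hrU hcov hloc hρ
  choose β hβ hβs hβI using fun i j : ι => exists_contDiff_support_subset_integral_eq_one
    ((Metric.isOpen_ball (x := c i) (ε := r i)).inter (Metric.isOpen_ball (x := c j) (ε := r j)))
    inter_subset_left
  have hnbr : ∀ i, {j | (Q i ∩ Q j).Nonempty}.Finite := fun i =>
    (hfin _ (hrU i) (isCompact_closedBall _ _)).subset fun j ⟨p, hi, hj⟩ =>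
      ⟨p, hj, Metric.ball_subset_closedBall hi⟩
  set N : ι → Finset ι := fun i => (hnbr i).toFinset with hN
  have hmem : ∀ i j, j ∈ N i ↔ (Q i ∩ Q j).Nonempty := fun i j => by simp [hN]
  have hsymm : ∀ i j, j ∈ N i → i ∈ N j := fun i j h => by
    rw [hmem, inter_comm, ← hmem]; exact h
  obtain ⟨F, hF⟩ := exists_flow_of_divergence N hsymm
    (fun f hf => eq_zero_of_locally_constant_on_open_cover (Q := Q)
      (fun i => Metric.isOpen_ball) (fun i => Metric.nonempty_ball.2 (hr i))
      (fun i => isCompact_closedBall (c i) (r i)) (fun i => Metric.ball_subset_closedBall) hrU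
      (fun p hp => mem_iUnion.2 (hcov p hp)) fun i j h => hf i j ((hmem i j).2 h))
    (fun i => ∫ p, u i p)
  set T : ι → ι → (Fin 2 → ℝ) → ℝ := fun i j p => F i j * β i j p - F j i * β j i p with hT
  have hTs : ∀ i j, Function.support (T i j) ⊆ Q i ∩ Q j := fun i j p hp => by
    by_contra h
    have h1 : β i j p = 0 := Function.notMem_support.1 fun h' => h (hβs i j h')
    have h2 : β j i p = 0 := Function.notMem_support.1 fun h' => h (hβs j i h').symm
    exact hp (by simp [hT, h1, h2])
  have hTc : ∀ i j, ContDiff ℝ ∞ (T i j) := fun i j =>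
    (contDiff_const.mul (hβ i j)).sub (contDiff_const.mul (hβ j i))
  have hint : ∀ i (w : (Fin 2 → ℝ) → ℝ), ContDiff ℝ ∞ w → Function.support w ⊆ Q i →
      Integrable w := fun i w hw hs =>
    integrable_of_continuous_of_support_subset_ball hw.continuous hs
  have hTI : ∀ i, ∀ j ∈ N i, ∫ p, T i j p = F i j - F j i := fun i j hj => by
    have hj' := (hmem i j).1 hj
    simp only [hT]
    rw [integral_sub ((hint i _ (hβ i j) ((hβs i j).trans inter_subset_left)).const_mul _)
      ((hint i _ (hβ j i) ((hβs j i).trans inter_subset_right)).const_mul _),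
      integral_const_mul, integral_const_mul, hβI i j hj',
      hβI j i (inter_comm (Q i) (Q j) ▸ hj'), mul_one, mul_one]
  have hTint : ∀ i j, Integrable (T i j) := fun i j =>
    hint i _ (hTc i j) ((hTs i j).trans inter_subset_left)
  have hsol : ∀ i, ∃ g h : (Fin 2 → ℝ) → ℝ, ContDiff ℝ ∞ g ∧ ContDiff ℝ ∞ h ∧
      Function.support g ⊆ Q i ∧ Function.support h ⊆ Q i ∧
      ∀ p, opX h p - opY g p = u i p - ∑ j ∈ N i, T i j p := fun i => by
    refine exists_opX_sub_opY_of_support_subset_ball (hr i)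
      ((hu i).sub (ContDiff.sum fun j _ => hTc i j)) (fun p hp => ?_) ?_
    · by_contra h
      have h1 : u i p = 0 := Function.notMem_support.1 fun h' => h (hus i h')
      have h2 : ∀ j, T i j p = 0 := fun j =>
        Function.notMem_support.1 fun h' => h (hTs i j h').1
      exact hp (by simp [h1, h2])
    · rw [integral_sub (hint i _ (hu i) (hus i)) (integrable_finsetSum _ fun j _ => hTint i j),
        integral_finsetSum _ fun j _ => hTint i j, Finset.sum_congr rfl (hTI i), hF, sub_self]
  choose g h hg hh hgs hhs heq using hsol
  refine ⟨fun q => ∑ᶠ i, g i q, fun q => ∑ᶠ i, h i q, fun p hp => ?_, fun p hp => ?_,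
    fun p hp => ?_⟩
  · obtain ⟨S, hS⟩ := hloc p hp
    exact (contDiffAt_finsum hgs hg hS).contDiffWithinAt
  · obtain ⟨S, hS⟩ := hloc p hp
    exact (contDiffAt_finsum hhs hh hS).contDiffWithinAt
  · obtain ⟨S, hS⟩ := hloc p hp
    have hSp := hS.self_of_nhds
    have hcancel : ∑ i ∈ S, ∑ j ∈ N i, T i j p = 0 := by
      have hNS : ∀ i, ∑ j ∈ N i, T i j p = ∑ j ∈ S, T i j p := fun i => by
        rw [← finsum_eq_sum_of_support_subset (s := N i) (fun j => T i j p)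
            fun j hj => (hmem i j).2 ⟨p, hTs i j hj⟩,
          ← finsum_eq_sum_of_support_subset (s := S) (fun j => T i j p)
            fun j hj => hSp j (hTs i j hj).2]
      rw [Finset.sum_congr rfl fun i _ => hNS i]
      simp only [hT, Finset.sum_sub_distrib]
      rw [Finset.sum_comm, sub_self]
    calc opX (fun q => ∑ᶠ i, h i q) p - opY (fun q => ∑ᶠ i, g i q) p
        = ∑ i ∈ S, (opX (h i) p - opY (g i) p) := by
          simp only [opX, opY, fderiv_finsum hgs hg hS, fderiv_finsum hhs hh hS,
            sum_apply, Finset.sum_sub_distrib]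
      _ = ∑ i ∈ S, u i p := by
          simp only [heq, Finset.sum_sub_distrib, hcancel, sub_zero]
      _ = ρ p := by
          rw [← huρ p hp, finsum_eq_sum_of_support_subset (s := S) (fun i => u i p)
            fun i hi => hSp i (hus i hi)]
end

section
/- Let U ⊆ ℝ² be an open set. The second Grushin sequence of operators is a complex: for every smooth f : U → ℝ one has X³(Yf) − (X²Y + XZ + W)(Xf) = 0 and Y²(Xf) − (YX − Z)(Yf) = 0 on U; for all smooth a, b : U → ℝ, setting c = X³b − (X²Y + XZ + W)a and d = Y²a − (YX − Z)b, one has X³d + (XY + Z)c = 0 and Y²c + (YX² − ZX + W)d = 0 on U; and for all smooth c, d : U → ℝ, setting g = X³d + (XY + Z)c and h = Y²c + (YX² − ZX + W)d, one has Xh − Yg = 0 on U. -/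
/-- The smooth functions on `U`, extended by zero to the plane. -/
def smoothOn (U : Set (Fin 2 → ℝ)) : AddSubgroup ((Fin 2 → ℝ) → ℝ) where
  carrier := {f | ContDiffOn ℝ (⊤ : ℕ∞) f U ∧ ∀ p ∉ U, f p = 0}
  zero_mem' := ⟨contDiffOn_const, fun _ _ => rfl⟩
  add_mem' hf hg := ⟨hf.1.add hg.1, fun p hp => by simp [hf.2 p hp, hg.2 p hp]⟩
  neg_mem' hf := ⟨hf.1.neg, fun p hp => by simp [hf.2 p hp]⟩

namespace smoothOn

open Set

variable {U : Set (Fin 2 → ℝ)}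

theorem differentiableAt (hU : IsOpen U) (u : smoothOn U) {p : Fin 2 → ℝ} (hp : p ∈ U) :
    DifferentiableAt ℝ u.1 p :=
  (u.2.1.contDiffAt (hU.mem_nhds hp)).differentiableAt (by simp)

theorem ext_of_eqOn {u v : smoothOn U} (h : EqOn u.1 v.1 U) : u = v := by
  ext p
  by_cases hp : p ∈ U
  · exact h hp
  · rw [u.2.2 p hp, v.2.2 p hp]

/-- The extension by zero of a function which is smooth on `U`. -/
noncomputable def ofContDiffOn {f : (Fin 2 → ℝ) → ℝ} (hf : ContDiffOn ℝ (⊤ : ℕ∞) f U) :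
    smoothOn U :=
  ⟨U.indicator f, hf.congr fun _ hp => indicator_of_mem hp f,
    fun _ hp => indicator_of_notMem hp f⟩

theorem eqOn_ofContDiffOn {f : (Fin 2 → ℝ) → ℝ} (hf : ContDiffOn ℝ (⊤ : ℕ∞) f U) :
    EqOn f (ofContDiffOn hf).1 U :=
  fun _ hp => (indicator_of_mem hp f).symm

theorem contDiffOn_fderiv_apply (hU : IsOpen U) (w : Fin 2 → ℝ) (u : smoothOn U) :
    ContDiffOn ℝ (⊤ : ℕ∞) (fun p => fderiv ℝ u.1 p w) U :=
  (u.2.1.fderiv_of_isOpen hU (by simp)).clm_apply contDiffOn_const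

/-- The derivative in the direction `w`, as an operator on the smooth functions on `U`. -/
noncomputable def dirDeriv (hU : IsOpen U) (w : Fin 2 → ℝ) : smoothOn U →+ smoothOn U :=
  AddMonoidHom.mk' (fun u => ofContDiffOn (contDiffOn_fderiv_apply hU w u)) fun u v =>
    ext_of_eqOn fun p hp => by
      simp [ofContDiffOn, hp, fderiv_add (differentiableAt hU u hp) (differentiableAt hU v hp)]

theorem dirDeriv_apply (hU : IsOpen U) (w : Fin 2 → ℝ) (u : smoothOn U) {p : Fin 2 → ℝ}
    (hp : p ∈ U) : (dirDeriv hU w u).1 p = fderiv ℝ u.1 p w :=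
  (eqOn_ofContDiffOn (contDiffOn_fderiv_apply hU w u) hp).symm

/-- Multiplication by the coordinate `x`. -/
def mulX : smoothOn U →+ smoothOn U :=
  AddMonoidHom.mk' (fun u => ⟨fun p => p 0 * u.1 p,
    (contDiff_apply ℝ ℝ (0 : Fin 2)).contDiffOn.mul u.2.1,
    fun p hp => by simp [u.2.2 p hp]⟩) fun u v => by
      ext p
      simp [mul_add]

theorem mulX_apply (u : smoothOn U) (p : Fin 2 → ℝ) : (mulX u).1 p = p 0 * u.1 p := rfl

theorem fderiv_eq_of_eqOn (hU : IsOpen U) {f g : (Fin 2 → ℝ) → ℝ} (h : EqOn f g U)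
    {p : Fin 2 → ℝ} (hp : p ∈ U) : fderiv ℝ f p = fderiv ℝ g p :=
  (h.eventuallyEq_of_mem (hU.mem_nhds hp)).fderiv_eq

theorem dirDeriv_mulX (hU : IsOpen U) (w : Fin 2 → ℝ) (u : smoothOn U) {p : Fin 2 → ℝ}
    (hp : p ∈ U) :
    (dirDeriv hU w (mulX u)).1 p = p 0 * (dirDeriv hU w u).1 p + w 0 * u.1 p := by
  have hx : HasFDerivAt (fun q : Fin 2 → ℝ => q 0)
      (ContinuousLinearMap.proj (R := ℝ) (φ := fun _ : Fin 2 => ℝ) 0) p := hasFDerivAt_apply 0 p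
  have h : HasFDerivAt (mulX u).1 _ p := hx.mul (differentiableAt hU u hp).hasFDerivAt
  rw [dirDeriv_apply hU w _ hp, dirDeriv_apply hU w _ hp, h.fderiv]
  simp [mul_comm]

theorem dirDeriv_comm (hU : IsOpen U) (v w : Fin 2 → ℝ) (u : smoothOn U) :
    dirDeriv hU v (dirDeriv hU w u) = dirDeriv hU w (dirDeriv hU v u) := by
  refine ext_of_eqOn fun p hp => ?_
  have hu := u.2.1.contDiffAt (hU.mem_nhds hp)
  have hd : DifferentiableAt ℝ (fderiv ℝ u.1) p :=
    (hu.fderiv_right (m := 1) (by norm_cast)).differentiableAt (by simp)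
  have key (a b : Fin 2 → ℝ) : (dirDeriv hU a (dirDeriv hU b u)).1 p =
      fderiv ℝ (fderiv ℝ u.1) p a b := by
    rw [dirDeriv_apply hU a _ hp, fderiv_eq_of_eqOn hU (fun q hq => dirDeriv_apply hU b u hq) hp,
      fderiv_clm_apply hd (differentiableAt_const b)]
    simp
  rw [key, key]
  exact hu.isSymmSndFDerivAt (by simp; norm_cast) v w

/-- The operator `∂/∂x`. -/
noncomputable abbrev dX (hU : IsOpen U) : smoothOn U →+ smoothOn U := dirDeriv hU ![1, 0]

/-- The operator `∂/∂y`. -/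
noncomputable abbrev dY (hU : IsOpen U) : smoothOn U →+ smoothOn U := dirDeriv hU ![0, 1]

theorem dX_mulX (hU : IsOpen U) (u : smoothOn U) : dX hU (mulX u) = mulX (dX hU u) + u :=
  ext_of_eqOn fun p hp => by simp [dirDeriv_mulX hU _ u hp, mulX_apply]

theorem dY_mulX (hU : IsOpen U) (u : smoothOn U) : dY hU (mulX u) = mulX (dY hU u) :=
  ext_of_eqOn fun p hp => by simp [dirDeriv_mulX hU _ u hp, mulX_apply]

theorem dY_dX (hU : IsOpen U) (u : smoothOn U) : dY hU (dX hU u) = dX hU (dY hU u) :=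
  dirDeriv_comm hU _ _ u

section Represent

variable {f g : (Fin 2 → ℝ) → ℝ} {u v : smoothOn U}

theorem eqOn_add (hf : EqOn f u.1 U) (hg : EqOn g v.1 U) :
    EqOn (fun p => f p + g p) (u + v).1 U :=
  fun p hp => by simp [hf hp, hg hp]

theorem eqOn_sub (hf : EqOn f u.1 U) (hg : EqOn g v.1 U) :
    EqOn (fun p => f p - g p) (u - v).1 U :=
  fun p hp => by simp [hf hp, hg hp]

theorem fderiv_vertical (hU : IsOpen U) (hf : EqOn f u.1 U) {p : Fin 2 → ℝ} (hp : p ∈ U) (t : ℝ) :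
    fderiv ℝ f p ![0, t] = t * (dY hU u).1 p := by
  have ht : (![0, t] : Fin 2 → ℝ) = t • ![0, 1] := by simp
  rw [ht, map_smul, fderiv_eq_of_eqOn hU hf hp, dirDeriv_apply hU _ u hp, smul_eq_mul]

theorem eqOn_opX (hU : IsOpen U) (hf : EqOn f u.1 U) : EqOn (opX f) (dX hU u).1 U :=
  fun p hp => by rw [opX, fderiv_eq_of_eqOn hU hf hp, dirDeriv_apply hU _ u hp]

theorem eqOn_opY (hU : IsOpen U) (hf : EqOn f u.1 U) :
    EqOn (opY f) (mulX (mulX (dY hU u))).1 U :=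
  fun p hp => by rw [opY, fderiv_vertical hU hf hp, mulX_apply, mulX_apply]; ring

theorem eqOn_opZ (hU : IsOpen U) (hf : EqOn f u.1 U) :
    EqOn (opZ f) (2 • mulX (dY hU u)).1 U :=
  fun p hp => by
    rw [opZ, fderiv_vertical hU hf hp]
    simp [mulX_apply, mul_assoc]

theorem eqOn_opW (hU : IsOpen U) (hf : EqOn f u.1 U) : EqOn (opW f) (2 • dY hU u).1 U :=
  fun p hp => by
    rw [opW, fderiv_vertical hU hf hp]
    simp

theorem eq_zero_of_eqOn (hf : EqOn f u.1 U) (hu : u = 0) {p : Fin 2 → ℝ} (hp : p ∈ U) :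
    f p = 0 := by
  rw [hf hp, hu]
  rfl

end Represent

end smoothOn

open smoothOn in
theorem second_grushin_is_complex
    (U : Set (Fin 2 → ℝ)) (hU : IsOpen U) :
    (∀ f : (Fin 2 → ℝ) → ℝ, ContDiffOn ℝ (⊤ : ℕ∞) f U →
      ∀ p ∈ U,
        opX (opX (opX (opY f))) p -
          (opX (opX (opY (opX f))) p + opX (opZ (opX f)) p + opW (opX f) p)
          = 0 ∧
        opY (opY (opX f)) p - (opY (opX (opY f)) p - opZ (opY f) p) = 0) ∧
    (∀ a b : (Fin 2 → ℝ) → ℝ, ContDiffOn ℝ (⊤ : ℕ∞) a U → ContDiffOn ℝ (⊤ : ℕ∞) b U →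
      ∀ c d : (Fin 2 → ℝ) → ℝ,
      c = (fun q => opX (opX (opX b)) q -
            (opX (opX (opY a)) q + opX (opZ a) q + opW a q)) →
      d = (fun q => opY (opY a) q - (opY (opX b) q - opZ b q)) →
      ∀ p ∈ U,
        opX (opX (opX d)) p + (opX (opY c) p + opZ c p) = 0 ∧
        opY (opY c) p +
          (opY (opX (opX d)) p - opZ (opX d) p + opW d p) = 0) ∧
    (∀ c d : (Fin 2 → ℝ) → ℝ, ContDiffOn ℝ (⊤ : ℕ∞) c U → ContDiffOn ℝ (⊤ : ℕ∞) d U →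
      ∀ g h : (Fin 2 → ℝ) → ℝ,
      g = (fun q => opX (opX (opX d)) q + (opX (opY c) q + opZ c q)) →
      h = (fun q => opY (opY c) q +
            (opY (opX (opX d)) q - opZ (opX d) q + opW d q)) →
      ∀ p ∈ U, opX h p - opY g p = 0) := by
  refine ⟨fun f hf p hp => ?_, fun a b ha hb c d hc hd p hp => ?_,
    fun c d hc hd g h hg hh p hp => ?_⟩
  · replace hf := eqOn_ofContDiffOn hf
    constructor
    · exact eq_zero_of_eqOn (eqOn_sub (eqOn_opX hU (eqOn_opX hU (eqOn_opX hU (eqOn_opY hU hf))))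
        (eqOn_add (eqOn_add (eqOn_opX hU (eqOn_opX hU (eqOn_opY hU (eqOn_opX hU hf))))
        (eqOn_opX hU (eqOn_opZ hU (eqOn_opX hU hf)))) (eqOn_opW hU (eqOn_opX hU hf))))
        (by simp only [map_add, map_nsmul, dX_mulX, dY_dX]; abel) hp
    · exact eq_zero_of_eqOn (eqOn_sub (eqOn_opY hU (eqOn_opY hU (eqOn_opX hU hf))) (eqOn_sub
        (eqOn_opY hU (eqOn_opX hU (eqOn_opY hU hf))) (eqOn_opZ hU (eqOn_opY hU hf))))
        (by simp only [map_add, dX_mulX, dY_mulX, dY_dX]; abel) hp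
  · replace ha := eqOn_ofContDiffOn ha
    replace hb := eqOn_ofContDiffOn hb
    have hc' := eqOn_sub (eqOn_opX hU (eqOn_opX hU (eqOn_opX hU hb))) (eqOn_add (eqOn_add
        (eqOn_opX hU (eqOn_opX hU (eqOn_opY hU ha))) (eqOn_opX hU (eqOn_opZ hU ha)))
        (eqOn_opW hU ha))
    have hd' := eqOn_sub (eqOn_opY hU (eqOn_opY hU ha)) (eqOn_sub (eqOn_opY hU (eqOn_opX hU hb))
        (eqOn_opZ hU hb))
    rw [← hc] at hc'
    rw [← hd] at hd'
    constructor
    · exact eq_zero_of_eqOn (eqOn_add (eqOn_opX hU (eqOn_opX hU (eqOn_opX hU hd'))) (eqOn_add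
        (eqOn_opX hU (eqOn_opY hU hc')) (eqOn_opZ hU hc')))
        (by simp only [map_add, map_sub, map_nsmul, dX_mulX, dY_mulX, dY_dX]; abel) hp
    · exact eq_zero_of_eqOn (eqOn_add (eqOn_opY hU (eqOn_opY hU hc')) (eqOn_add (eqOn_sub
        (eqOn_opY hU (eqOn_opX hU (eqOn_opX hU hd'))) (eqOn_opZ hU (eqOn_opX hU hd')))
        (eqOn_opW hU hd')))
        (by simp only [map_add, map_sub, map_nsmul, dX_mulX, dY_mulX, dY_dX]; abel) hp
  · replace hc := eqOn_ofContDiffOn hc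
    replace hd := eqOn_ofContDiffOn hd
    have hg' := eqOn_add (eqOn_opX hU (eqOn_opX hU (eqOn_opX hU hd))) (eqOn_add (eqOn_opX hU
        (eqOn_opY hU hc)) (eqOn_opZ hU hc))
    have hh' := eqOn_add (eqOn_opY hU (eqOn_opY hU hc)) (eqOn_add (eqOn_sub (eqOn_opY hU
        (eqOn_opX hU (eqOn_opX hU hd))) (eqOn_opZ hU (eqOn_opX hU hd))) (eqOn_opW hU hd))
    rw [← hg] at hg'
    rw [← hh] at hh'
    exact eq_zero_of_eqOn (eqOn_sub (eqOn_opX hU hh') (eqOn_opY hU hg'))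
        (by simp only [map_add, map_sub, map_nsmul, dX_mulX, dY_mulX, dY_dX]; abel) hp
end
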